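/- Let X be a Lévy process with X_0 = 0 and no positive jumps, non-deterministic, not the negative of a subordinator, and drifting to −∞, with Laplace exponent θ and q ∈ (0,∞) its unique strictly positive root; let ρ be the (a.s. unique) time of overall maximum of X. Let θ_q(z) := θ(z+q) for z ∈ ℝ₊, with strictly increasing inverse θ_q^{−1}: ℝ₊ → ℝ₊, and τ_x := inf{t : X_t = x}. Then: (i) the joint Laplace transform is E_P[exp(−aρ − bX_ρ)] = q / (q + θ_q^{−1}(a) + b) for all (a,b) ∈ ℝ₊ × ℝ₊; (ii) the joint density satisfies P[ρ ∈ dt, X_ρ ∈ dx] = q P[τ_x ∈ dt] dx = (qx/t) P[X_t ∈ dx] dt for (t,x) ∈ (0,∞)×(0,∞); (iii) the density of ρ under P satisfies P[ρ ∈ dt] = (q/t) E_P[X_t 1_{{X_t > 0}}] dt for t ∈ (0,∞). -/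

import Mathlib

open MeasureTheory Filter Set ProbabilityTheory
open scoped ENNReal NNReal Topology

noncomputable section

namespace LevyMax

/-- `τ_x = inf{t : X_t = x}` (`= ∞` if the level is never hit). -/
noncomputable def hitLevel {Ω : Type*} (X : ℝ≥0 → Ω → ℝ) (x : ℝ) (ω : Ω) : ℝ≥0∞ :=
  sInf ((fun t : ℝ≥0 => (t : ℝ≥0∞)) '' {t : ℝ≥0 | X t ω = x})

/-! ### First passage times of a path -/

/-- Right-continuous paths started at `0`, with left limits and without positive jumps. -/
structure IsRegularPath (f : ℝ≥0 → ℝ) : Prop where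
  zero : f 0 = 0
  right_cont : ∀ t, ContinuousWithinAt f (Ici t) t
  left_lim : ∀ t, t ≠ 0 → ∃ c, Tendsto f (𝓝[<] t) (𝓝 c) ∧ f t ≤ c

/-- The first time after `r`, along rational times, at which `f` exceeds the level `L`. -/
def passage (f : ℝ≥0 → ℝ) (r : ℝ≥0) (L : ℝ) : ℝ≥0∞ :=
  ⨅ s : ℚ, if r ≤ Real.toNNReal s ∧ L < f (Real.toNNReal s) then
    (Real.toNNReal s : ℝ≥0∞) else ⊤

section Passage

variable {f : ℝ≥0 → ℝ} {r s : ℝ≥0} {L L' : ℝ} {t : ℝ≥0∞}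

theorem passage_lt_iff : passage f r L < t ↔ ∃ s : ℚ, r ≤ Real.toNNReal s ∧
    L < f (Real.toNNReal s) ∧ (Real.toNNReal s : ℝ≥0∞) < t := by
  unfold passage
  rw [iInf_lt_iff]
  refine exists_congr fun s => ?_
  split_ifs with h
  · simp [h.1, h.2]
  · simp only [not_top_lt, false_iff]
    exact fun h' => h ⟨h'.1, h'.2.1⟩

theorem passage_mono (h : L ≤ L') : passage f r L ≤ passage f r L' := by
  refine le_of_forall_gt fun t ht => ?_
  obtain ⟨s, h1, h2, h3⟩ := passage_lt_iff.1 ht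
  exact passage_lt_iff.2 ⟨s, h1, h.trans_lt h2, h3⟩

theorem le_passage : (r : ℝ≥0∞) ≤ passage f r L := by
  by_contra h
  obtain ⟨s, h1, h2, h3⟩ := passage_lt_iff.1 (not_le.1 h)
  exact absurd (ENNReal.coe_lt_coe.1 h3) (not_lt.2 h1)

theorem IsRegularPath.passage_lt (hf : IsRegularPath f) (hs : r ≤ s) (hL : L < f s)
    (ht : (s : ℝ≥0∞) < t) : passage f r L < t := by
  have h1 : ∀ᶠ u in 𝓝[>] s, L < f u :=
    ((hf.right_cont s).mono Ioi_subset_Ici_self).eventually (lt_mem_nhds hL)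
  have h2 : ∀ᶠ u : ℝ≥0 in 𝓝[>] s, (u : ℝ≥0∞) < t :=
    (ENNReal.continuous_coe.continuousWithinAt (s := Ioi s) (x := s)).eventually (gt_mem_nhds ht)
  obtain ⟨u, hu, hsub⟩ := (mem_nhdsGT_iff_exists_Ioo_subset).1 (h1.and h2)
  obtain ⟨v, -, hv1, hv2⟩ := NNReal.lt_iff_exists_rat_btwn _ _ |>.1 hu
  have := hsub ⟨hv1, hv2⟩
  exact passage_lt_iff.2 ⟨v, hs.trans hv1.le, this.1, this.2⟩

theorem IsRegularPath.passage_le (hf : IsRegularPath f) (hs : r ≤ s) (hL : L < f s) :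
    passage f r L ≤ s :=
  le_of_forall_gt fun _ ht => hf.passage_lt hs hL ht

theorem IsRegularPath.le_of_lt_passage (hf : IsRegularPath f) (hs : r ≤ s)
    (h : (s : ℝ≥0∞) < passage f r L) : f s ≤ L := by
  by_contra hL
  exact absurd (hf.passage_le hs (not_le.1 hL)) (not_le.2 h)

theorem IsRegularPath.le_apply_passage (hf : IsRegularPath f) (h : passage f r L < ⊤) :
    L ≤ f (passage f r L).toNNReal := by
  obtain ⟨p, hp⟩ : ∃ p : ℝ≥0, (p : ℝ≥0∞) = passage f r L :=
    ⟨_, ENNReal.coe_toNNReal h.ne⟩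
  rw [← hp, ENNReal.toNNReal_coe]
  by_contra hL
  have h1 : ∀ᶠ u in 𝓝[≥] p, f u < L := (hf.right_cont p).eventually (gt_mem_nhds (not_le.1 hL))
  obtain ⟨u, hu, hsub⟩ := (mem_nhdsGE_iff_exists_Ico_subset).1 h1
  obtain ⟨s, hs1, hs2, hs3⟩ := passage_lt_iff.1
    (show passage f r L < u by rw [← hp]; exact ENNReal.coe_lt_coe.2 hu)
  have h4 : (p : ℝ≥0∞) ≤ Real.toNNReal s := by
    rw [hp]; exact hf.passage_le hs1 hs2
  exact absurd (hsub ⟨ENNReal.coe_le_coe.1 h4, ENNReal.coe_lt_coe.1 hs3⟩) (not_lt.2 hs2.le)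

theorem IsRegularPath.apply_passage_le (hf : IsRegularPath f) (hr : f r ≤ L)
    (h : passage f r L < ⊤) : f (passage f r L).toNNReal ≤ L := by
  obtain ⟨p, hp⟩ : ∃ p : ℝ≥0, (p : ℝ≥0∞) = passage f r L :=
    ⟨_, ENNReal.coe_toNNReal h.ne⟩
  have hrp : r ≤ p := ENNReal.coe_le_coe.1 (hp ▸ le_passage)
  rw [← hp, ENNReal.toNNReal_coe]
  rcases hrp.eq_or_lt with rfl | hlt
  · exact hr
  obtain ⟨c, hc, hle⟩ := hf.left_lim p (pos_of_gt hlt).ne'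
  have : (𝓝[<] p).NeBot := nhdsLT_neBot_of_exists_lt ⟨r, hlt⟩
  refine hle.trans (le_of_tendsto hc ?_)
  filter_upwards [Ioo_mem_nhdsLT hlt] with s hs
  exact hf.le_of_lt_passage hs.1.le (hp ▸ ENNReal.coe_lt_coe.2 hs.2)

theorem IsRegularPath.apply_passage (hf : IsRegularPath f) (hr : f r ≤ L)
    (h : passage f r L < ⊤) : f (passage f r L).toNNReal = L :=
  le_antisymm (hf.apply_passage_le hr h) (hf.le_apply_passage h)

end Passage

/-! ### Optional times and the strong Markov property -/

/-- A process with stationary independent increments relative to `ℱ` whose paths are almost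
surely right-continuous with left limits and without positive jumps. -/
structure IsSpectrallyNegative {Ω : Type*} {m : MeasurableSpace Ω} (ℱ : Filtration ℝ≥0 m)
    (P : Measure Ω) (X : ℝ≥0 → Ω → ℝ) : Prop where
  adapted : ∀ t, Measurable[ℱ t] (X t)
  path : ∀ᵐ ω ∂P, IsRegularPath fun t => X t ω
  stationary : ∀ s t : ℝ≥0, Measure.map (fun ω => X (s + t) ω - X s ω) P = Measure.map (X t) P
  indep : ∀ s t : ℝ≥0, s ≤ t → Indep (MeasurableSpace.comap (fun ω => X t ω - X s ω)
    (inferInstance : MeasurableSpace ℝ)) (ℱ s) P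

/-- `S` is an optional time of the filtration. -/
def IsOptionalTime {Ω : Type*} {m : MeasurableSpace Ω} (ℱ : Filtration ℝ≥0 m)
    (S : Ω → ℝ≥0∞) : Prop :=
  ∀ t : ℝ≥0, MeasurableSet[ℱ t] {ω | S ω < t}

/-- `W` is known at the optional time `S`. -/
def IsKnownAt {Ω : Type*} {m : MeasurableSpace Ω} (ℱ : Filtration ℝ≥0 m)
    (S : Ω → ℝ≥0∞) (W : Ω → ℝ≥0∞) : Prop :=
  ∀ t : ℝ≥0, Measurable[ℱ t] ({ω | S ω < t}.indicator W)

/-- The discount factor `exp (-c S)`, which vanishes for `S = ∞`. -/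
def discount (c : ℝ) (S : ℝ≥0∞) : ℝ≥0∞ :=
  if S < ⊤ then ENNReal.ofReal (Real.exp (-c * S.toReal)) else 0

/-- The first point of the grid `ℕ / (n + 1)` after `t`. -/
def gridAbove (n : ℕ) (t : ℝ≥0) : ℝ≥0 := ((⌊(n + 1 : ℝ≥0) * t⌋₊ : ℝ≥0) + 1) / (n + 1)

theorem lt_gridAbove (n : ℕ) (t : ℝ≥0) : t < gridAbove n t := by
  rw [gridAbove, lt_div_iff₀ (by positivity), mul_comm]
  exact Nat.lt_floor_add_one _

theorem gridAbove_le (n : ℕ) (t : ℝ≥0) : gridAbove n t ≤ t + 1 / (n + 1) := by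
  rw [gridAbove, add_div]
  gcongr
  rw [div_le_iff₀ (by positivity), mul_comm t]
  exact Nat.floor_le (by positivity)

theorem tendsto_gridAbove (t : ℝ≥0) :
    Tendsto (fun n => gridAbove n t) atTop (𝓝[≥] t) := by
  refine tendsto_nhdsWithin_iff.2 ⟨?_, Eventually.of_forall fun n => (lt_gridAbove n t).le⟩
  refine tendsto_of_tendsto_of_tendsto_of_le_of_le tendsto_const_nhds ?_
    (fun n => (lt_gridAbove n t).le) (fun n => gridAbove_le n t)
  simpa using (tendsto_const_nhds (x := t)).add
    (tendsto_one_div_add_atTop_nhds_zero_nat (𝕜 := ℝ≥0))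

/-- A jointly measurable version of a right-continuous process. -/
def jointVersion {Ω : Type*} (X : ℝ≥0 → Ω → ℝ) (p : ℝ≥0 × Ω) : ℝ :=
  limsup (fun n : ℕ => X (gridAbove n p.1) p.2) atTop

theorem measurable_jointVersion {Ω : Type*} [MeasurableSpace Ω] {X : ℝ≥0 → Ω → ℝ}
    (hX : ∀ t, Measurable (X t)) : Measurable (jointVersion X) := by
  refine Measurable.limsup fun n => ?_
  let Y : ℕ × Ω → ℝ := fun p => X (((p.1 : ℝ≥0) + 1) / (n + 1)) p.2
  have h1 : Measurable Y := by
    refine measurable_from_prod_countable_right fun k => ?_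
    change Measurable (X (((k : ℝ≥0) + 1) / (n + 1)))
    exact hX _
  have h2 : Measurable fun p : ℝ≥0 × Ω => (⌊(n + 1 : ℝ≥0) * p.1⌋₊, p.2) :=
    (Nat.measurable_floor.comp (measurable_fst.const_mul _)).prodMk measurable_snd
  have h3 : (fun p : ℝ≥0 × Ω => X (gridAbove n p.1) p.2) =
      Y ∘ fun p : ℝ≥0 × Ω => (⌊(n + 1 : ℝ≥0) * p.1⌋₊, p.2) := by
    funext p
    simp only [Function.comp_apply, gridAbove, Y]
  rw [h3]
  exact h1.comp h2

theorem IsRegularPath.jointVersion_eq {Ω : Type*} {X : ℝ≥0 → Ω → ℝ} {ω : Ω}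
    (h : IsRegularPath fun t => X t ω) (t : ℝ≥0) : jointVersion X (t, ω) = X t ω :=
  Tendsto.limsup_eq (Tendsto.comp (h.right_cont t) (tendsto_gridAbove t))

section Times

variable {Ω : Type*} {m : MeasurableSpace Ω} {ℱ : Filtration ℝ≥0 m} {S T : Ω → ℝ≥0∞}
  {W : Ω → ℝ≥0∞}

theorem discount_antitone {c : ℝ} (hc : 0 ≤ c) : Antitone (discount c) := by
  intro S T h
  unfold discount
  split_ifs with h1 h2
  · refine ENNReal.ofReal_le_ofReal (Real.exp_le_exp.2 ?_)
    have := ENNReal.toReal_mono h1.ne h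
    nlinarith
  · exact absurd (h.trans_lt h1) h2
  · positivity
  · exact le_rfl

theorem discount_le_one {c : ℝ} (hc : 0 ≤ c) (S : ℝ≥0∞) : discount c S ≤ 1 := by
  refine (discount_antitone hc (zero_le (a := S))).trans ?_
  simp [discount]

@[simp] theorem discount_top (c : ℝ) : discount c ⊤ = 0 := by simp [discount]

@[simp] theorem discount_zero_right (c : ℝ) : discount c 0 = 1 := by simp [discount]

theorem measurable_discount (c : ℝ) : Measurable (discount c) :=
  Measurable.ite measurableSet_Iio (by fun_prop) measurable_const

theorem IsOptionalTime.measurable (hS : IsOptionalTime ℱ S) : Measurable S := by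
  refine measurable_of_Iio fun t => ?_
  induction t with
  | top =>
    have : S ⁻¹' Iio ⊤ = ⋃ n : ℕ, {ω | S ω < (n : ℝ≥0)} := by
      ext ω
      simp only [mem_preimage, mem_Iio, mem_iUnion, mem_ofPred_eq]
      constructor
      · intro h
        obtain ⟨n, hn⟩ := ENNReal.exists_nat_gt h.ne
        exact ⟨n, by simpa using hn⟩
      · rintro ⟨n, hn⟩
        exact hn.trans ENNReal.coe_lt_top
    rw [this]
    exact MeasurableSet.iUnion fun n => ℱ.le _ _ (hS n)
  | coe t => exact ℱ.le _ _ (hS t)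

theorem IsOptionalTime.zero : IsOptionalTime ℱ fun _ => 0 := fun t => by
  by_cases h : (0 : ℝ≥0∞) < t
  · simp [h]
  · simp [h]

theorem IsOptionalTime.isKnownAt_comp (hS : IsOptionalTime ℱ S) {φ : ℝ≥0∞ → ℝ≥0∞}
    (hφ : Measurable φ) : IsKnownAt ℱ S fun ω => φ (S ω) := by
  intro t
  have hmin : Measurable[ℱ t] fun ω => min (S ω) t := by
    refine measurable_of_Iio (mδ := ℱ t) fun s => ?_
    rcases le_or_gt s t with h | h
    · lift s to ℝ≥0 using ne_top_of_le_ne_top ENNReal.coe_ne_top h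
      have : (fun ω => min (S ω) (t : ℝ≥0∞)) ⁻¹' Iio (s : ℝ≥0∞) = {ω | S ω < s} := by
        ext ω
        simp only [mem_preimage, mem_Iio, min_lt_iff, mem_ofPred_eq, or_iff_left_iff_imp]
        exact fun h' => absurd h' (not_lt.2 h)
      rw [this]
      exact ℱ.mono (ENNReal.coe_le_coe.1 h) _ (hS s)
    · have : (fun ω => min (S ω) (t : ℝ≥0∞)) ⁻¹' Iio s = univ := by
        ext ω
        simp [h]
      rw [this]
      exact @MeasurableSet.univ _ (ℱ t)
  have : {ω | S ω < t}.indicator (fun ω => φ (S ω)) =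
      {ω | S ω < t}.indicator fun ω => φ (min (S ω) t) := by
    ext ω
    by_cases h : S ω < t
    · simp [h, h.le]
    · simp [h]
  rw [this]
  exact (hφ.comp hmin).indicator (hS t)

theorem IsKnownAt.mul {W' : Ω → ℝ≥0∞} (h : IsKnownAt ℱ S W) (h' : IsKnownAt ℱ S W') :
    IsKnownAt ℱ S fun ω => W ω * W' ω := fun t => by
  have : ({ω | S ω < t}.indicator fun ω => W ω * W' ω) =
      fun ω => {ω | S ω < t}.indicator W ω * {ω | S ω < t}.indicator W' ω :=
    indicator_mul _ _ _
  rw [this]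
  exact (h t).mul (h' t)

theorem IsKnownAt.mono (h : IsKnownAt ℱ S W) (hT : IsOptionalTime ℱ T) (hST : ∀ ω, S ω ≤ T ω) :
    IsKnownAt ℱ T W := fun t => by
  have : {ω | T ω < t}.indicator W = {ω | T ω < t}.indicator ({ω | S ω < t}.indicator W) := by
    rw [indicator_indicator]
    congr 1
    ext ω
    simpa using fun h => (hST ω).trans_lt h
  rw [this]
  exact (h t).indicator (hT t)

theorem IsOptionalTime.isKnownAt_one (hS : IsOptionalTime ℱ S) : IsKnownAt ℱ S fun _ => 1 :=
  hS.isKnownAt_comp (φ := fun _ => 1) measurable_const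

theorem IsKnownAt.measurable (h : IsKnownAt ℱ S W) (h0 : ∀ ω, S ω = ⊤ → W ω = 0) :
    Measurable W := by
  refine measurable_of_tendsto_metrizable (f := fun n : ℕ => {ω | S ω < (n : ℝ≥0)}.indicator W)
    (fun n => (h n).mono (ℱ.le _) le_rfl) (tendsto_pi_nhds.2 fun ω => ?_)
  refine tendsto_const_nhds.congr' ?_
  by_cases hω : S ω = ⊤
  · simp [hω, h0 ω hω]
  · obtain ⟨n, hn⟩ := ENNReal.exists_nat_gt hω
    filter_upwards [eventually_ge_atTop n] with k hk
    rw [indicator_of_mem]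
    simpa using hn.trans_le (by exact_mod_cast hk)

theorem isOptionalTime_passage {X : ℝ≥0 → Ω → ℝ} (hX : ∀ t, Measurable[ℱ t] (X t)) {r : ℝ≥0}
    {L : Ω → ℝ} (hL : Measurable[ℱ r] L) :
    IsOptionalTime ℱ fun ω => passage (fun t => X t ω) r (L ω) := by
  intro t
  have : {ω | passage (fun t => X t ω) r (L ω) < t} = ⋃ s : ℚ, {ω | r ≤ Real.toNNReal s ∧
      L ω < X (Real.toNNReal s) ω ∧ Real.toNNReal s < t} := by
    ext ω
    simp [passage_lt_iff]
  rw [this]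
  refine @MeasurableSet.iUnion _ _ (ℱ t) _ _ fun s => ?_
  by_cases h1 : r ≤ Real.toNNReal s <;> by_cases h2 : Real.toNNReal s < t
  · simp only [h1, h2, and_true, true_and]
    exact measurableSet_lt (mδ := ℱ t) (hL.mono (ℱ.mono (h1.trans h2.le)) le_rfl)
      ((hX _).mono (ℱ.mono h2.le) le_rfl)
  all_goals simp [h1, h2]

end Times

section StrongMarkov

variable {Ω : Type*} {m : MeasurableSpace Ω} {ℱ : Filtration ℝ≥0 m} {P : Measure Ω}
  {X : ℝ≥0 → Ω → ℝ} {S : Ω → ℝ≥0∞} {W : Ω → ℝ≥0∞}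

theorem IsSpectrallyNegative.measurable (hX : IsSpectrallyNegative ℱ P X) (t : ℝ≥0) :
    Measurable (X t) := (hX.adapted t).mono (ℱ.le t) le_rfl

theorem IsSpectrallyNegative.lintegral_increment (hX : IsSpectrallyNegative ℱ P X) (t u : ℝ≥0)
    {h : ℝ → ℝ≥0∞} (hh : Measurable h) {V : Ω → ℝ≥0∞} (hV : Measurable[ℱ t] V) :
    ∫⁻ ω, V ω * h (X (t + u) ω - X t ω) ∂P = (∫⁻ ω, V ω ∂P) * ∫⁻ ω, h (X u ω) ∂P := by
  have hinc : Measurable fun ω => X (t + u) ω - X t ω :=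
    (hX.measurable _).sub (hX.measurable _)
  rw [lintegral_mul_eq_lintegral_mul_lintegral_of_independent_measurableSpace
    (g := fun ω => h (X (t + u) ω - X t ω)) (ℱ.le t)
    hinc.comap_le (hX.indep t (t + u) le_self_add).symm hV (hh.comp (comap_measurable _))]
  congr 1
  rw [← lintegral_map (μ := P) hh hinc, hX.stationary, lintegral_map hh (hX.measurable u)]

theorem tsum_grid_indicator (n : ℕ) (S W : Ω → ℝ≥0∞) (h0 : ∀ ω, S ω = ⊤ → W ω = 0)
    (F : ℝ≥0 → ℝ≥0∞) (ω : Ω) :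
    ∑' k : ℕ, {ω | S ω < ⊤ ∧ ⌊(n + 1 : ℝ≥0) * (S ω).toNNReal⌋₊ = k}.indicator W ω *
      F (((k : ℝ≥0) + 1) / (n + 1)) = W ω * F (gridAbove n (S ω).toNNReal) := by
  by_cases hω : S ω = ⊤
  · simp [hω, h0 ω hω]
  · rw [tsum_eq_single ⌊(n + 1 : ℝ≥0) * (S ω).toNNReal⌋₊]
    · rw [indicator_of_mem]
      · rfl
      · exact ⟨lt_top_iff_ne_top.2 hω, rfl⟩
    · intro k hk
      rw [indicator_of_notMem, zero_mul]
      exact fun h => hk h.2.symm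

theorem IsOptionalTime.measurable_grid_indicator (hS : IsOptionalTime ℱ S)
    (hW : IsKnownAt ℱ S W) (n k : ℕ) :
    Measurable[ℱ (((k : ℝ≥0) + 1) / (n + 1))]
      ({ω | S ω < ⊤ ∧ ⌊(n + 1 : ℝ≥0) * (S ω).toNNReal⌋₊ = k}.indicator W) := by
  set t : ℝ≥0 := ((k : ℝ≥0) + 1) / (n + 1) with ht
  set s : ℝ≥0 := (k : ℝ≥0) / (n + 1) with hs
  have hst : s ≤ t := by rw [hs, ht]; gcongr; exact le_self_add
  have : {ω | S ω < ⊤ ∧ ⌊(n + 1 : ℝ≥0) * (S ω).toNNReal⌋₊ = k}.indicator W =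
      {ω | S ω < s}ᶜ.indicator ({ω | S ω < t}.indicator W) := by
    rw [indicator_indicator]
    congr 1
    ext ω
    simp only [mem_ofPred_eq, mem_inter_iff, mem_compl_iff, not_lt]
    constructor
    · rintro ⟨h1, h2⟩
      rw [Nat.floor_eq_iff (by positivity)] at h2
      rw [← ENNReal.coe_toNNReal h1.ne, ENNReal.coe_le_coe, ENNReal.coe_lt_coe, hs, ht,
        div_le_iff₀ (by positivity), lt_div_iff₀ (by positivity), mul_comm _ (n + 1 : ℝ≥0)]
      exact h2
    · rintro ⟨h1, h2⟩
      have h3 : S ω < ⊤ := h2.trans ENNReal.coe_lt_top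
      refine ⟨h3, ?_⟩
      rw [← ENNReal.coe_toNNReal h3.ne, ENNReal.coe_le_coe, hs,
        div_le_iff₀ (by positivity), mul_comm _ (n + 1 : ℝ≥0)] at h1
      rw [← ENNReal.coe_toNNReal h3.ne, ENNReal.coe_lt_coe, ht,
        lt_div_iff₀ (by positivity), mul_comm _ (n + 1 : ℝ≥0)] at h2
      rw [Nat.floor_eq_iff (by positivity)]
      exact ⟨h1, h2⟩
  rw [this]
  exact (hW t).indicator (ℱ.mono hst _ (hS s)).compl

theorem IsSpectrallyNegative.lintegral_increment_grid (hX : IsSpectrallyNegative ℱ P X)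
    (hS : IsOptionalTime ℱ S) (hW : IsKnownAt ℱ S W) (h0 : ∀ ω, S ω = ⊤ → W ω = 0) (n : ℕ)
    (u : ℝ≥0) {h : ℝ → ℝ≥0∞} (hh : Measurable h) :
    (Measurable fun ω => W ω * h (X (gridAbove n (S ω).toNNReal + u) ω -
        X (gridAbove n (S ω).toNNReal) ω)) ∧
    ∫⁻ ω, W ω * h (X (gridAbove n (S ω).toNNReal + u) ω -
        X (gridAbove n (S ω).toNNReal) ω) ∂P =
      (∫⁻ ω, W ω ∂P) * ∫⁻ ω, h (X u ω) ∂P := by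
  have hm := hS.measurable_grid_indicator hW n
  have hterm : ∀ k : ℕ, Measurable fun ω =>
      {ω | S ω < ⊤ ∧ ⌊(n + 1 : ℝ≥0) * (S ω).toNNReal⌋₊ = k}.indicator W ω *
        h (X (((k : ℝ≥0) + 1) / (n + 1) + u) ω - X (((k : ℝ≥0) + 1) / (n + 1)) ω) := fun k =>
    ((hm k).mono (ℱ.le _) le_rfl).mul
      (hh.comp ((hX.measurable _).sub (hX.measurable _)))
  have hW' : ∀ ω, W ω = ∑' k : ℕ,
      {ω | S ω < ⊤ ∧ ⌊(n + 1 : ℝ≥0) * (S ω).toNNReal⌋₊ = k}.indicator W ω := fun ω => by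
    simpa using (tsum_grid_indicator n S W h0 (fun _ => 1) ω).symm
  have hsum : (fun ω => W ω * h (X (gridAbove n (S ω).toNNReal + u) ω -
      X (gridAbove n (S ω).toNNReal) ω)) = fun ω => ∑' k : ℕ,
        {ω | S ω < ⊤ ∧ ⌊(n + 1 : ℝ≥0) * (S ω).toNNReal⌋₊ = k}.indicator W ω *
        h (X (((k : ℝ≥0) + 1) / (n + 1) + u) ω - X (((k : ℝ≥0) + 1) / (n + 1)) ω) := by
    ext ω
    exact (tsum_grid_indicator n S W h0 (fun t => h (X (t + u) ω - X t ω)) ω).symm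
  constructor
  · rw [hsum]
    exact Measurable.tsum hterm
  · rw [hsum, lintegral_tsum fun k => (hterm k).aemeasurable]
    simp_rw [fun k : ℕ => hX.lintegral_increment (((k : ℝ≥0) + 1) / (n + 1)) u hh (hm k)]
    rw [ENNReal.tsum_mul_right, ← lintegral_tsum
      fun k => ((hm k).mono (ℱ.le _) le_rfl).aemeasurable]
    simp_rw [← hW']

/-- The strong Markov property at an optional time, for a single increment. -/
theorem IsSpectrallyNegative.strongMarkov [IsProbabilityMeasure P] (hX : IsSpectrallyNegative ℱ P X)
    (hS : IsOptionalTime ℱ S) (hW : IsKnownAt ℱ S W) (hW1 : ∀ ω, W ω ≤ 1)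
    (h0 : ∀ ω, S ω = ⊤ → W ω = 0) (u : ℝ≥0) {h : ℝ → ℝ≥0∞} (hh : Measurable h) :
    ∫⁻ ω, W ω * h (jointVersion X ((S ω).toNNReal + u, ω) -
        jointVersion X ((S ω).toNNReal, ω)) ∂P = (∫⁻ ω, W ω ∂P) * ∫⁻ ω, h (X u ω) ∂P := by
  have hWm : Measurable W := hW.measurable h0
  have hJ := measurable_jointVersion hX.measurable
  have hSm : Measurable fun ω => (S ω).toNNReal := hS.measurable.ennreal_toNNReal
  set D : Ω → ℝ := fun ω => jointVersion X ((S ω).toNNReal + u, ω) -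
        jointVersion X ((S ω).toNNReal, ω) with hD
  have hDm : Measurable D :=
    (hJ.comp ((hSm.add_const u).prodMk measurable_id)).sub (hJ.comp (hSm.prodMk measurable_id))
  have hfin : ∫⁻ ω, W ω ∂P ≠ ⊤ :=
    ne_top_of_le_ne_top (by simp) (lintegral_mono (μ := P) (g := fun _ => 1) hW1)
  have : IsFiniteMeasure (P.withDensity W) := isFiniteMeasure_withDensity hfin
  have hdens : ∀ g : ℝ → ℝ≥0∞, Measurable g →
      ∫⁻ ω, g (D ω) ∂P.withDensity W = ∫⁻ ω, W ω * g (D ω) ∂P := fun g hg =>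
    lintegral_withDensity_eq_lintegral_mul _ hWm (hg.comp hDm)
  have key : (P.withDensity W).map D = (∫⁻ ω, W ω ∂P) • P.map (X u) := by
    refine ext_of_forall_lintegral_eq_of_IsFiniteMeasure fun f => ?_
    have hf : Measurable fun x => (f x : ℝ≥0∞) :=
      (ENNReal.continuous_coe.comp f.continuous).measurable
    rw [lintegral_map hf hDm, hdens _ hf,
      lintegral_smul_measure, lintegral_map hf (hX.measurable u), smul_eq_mul]
    refine tendsto_nhds_unique (f := fun n : ℕ => ∫⁻ ω, W ω * f (X (gridAbove n (S ω).toNNReal + u)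
      ω - X (gridAbove n (S ω).toNNReal) ω) ∂P) (l := atTop) ?_ ?_
    · obtain ⟨C, hC⟩ : ∃ C : ℝ≥0, ∀ x, f x ≤ C := by
        refine ⟨nndist f 0, fun x => ?_⟩
        have := BoundedContinuousFunction.nndist_coe_le_nndist (f := f) (g := 0) x
        simpa using this
      refine tendsto_lintegral_of_dominated_convergence (fun _ => (C : ℝ≥0∞))
        (fun n => (hX.lintegral_increment_grid hS hW h0 n u hf).1)
        (fun n => Eventually.of_forall fun ω => ?_) (by simp) ?_
      · exact (mul_le_mul' (hW1 ω) (ENNReal.coe_le_coe.2 (hC _))).trans_eq (one_mul _)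
      · filter_upwards [hX.path] with ω hω
        refine ENNReal.Tendsto.const_mul ?_
          (Or.inr (ne_top_of_le_ne_top ENNReal.one_ne_top (hW1 ω)))
        rw [hD]
        simp only [hω.jointVersion_eq]
        refine ENNReal.tendsto_coe.2 ((f.continuous.tendsto _).comp (Tendsto.sub ?_ ?_))
        · refine Tendsto.comp (hω.right_cont _) ?_
          refine tendsto_nhdsWithin_iff.2 ⟨Tendsto.add_const u
            ((tendsto_gridAbove _).mono_right nhdsWithin_le_nhds), ?_⟩
          exact Eventually.of_forall fun n => add_le_add_left (lt_gridAbove n _).le u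
        · exact Tendsto.comp (hω.right_cont _) (tendsto_gridAbove _)
    · refine tendsto_const_nhds.congr fun n => ?_
      exact (hX.lintegral_increment_grid hS hW h0 n u hf).2.symm
  have := congrArg (fun μ => ∫⁻ x, h x ∂μ) key
  simpa only [lintegral_map hh hDm, hdens h hh,
    lintegral_smul_measure, lintegral_map hh (hX.measurable u), smul_eq_mul] using this

end StrongMarkov

section Resolvent

variable {Ω : Type*} {m : MeasurableSpace Ω} {ℱ : Filtration ℝ≥0 m} {P : Measure Ω}
  {X : ℝ≥0 → Ω → ℝ} {S : Ω → ℝ≥0∞} {W : Ω → ℝ≥0∞}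

/-- The resolvent `h ↦ ∫ exp (-c u) E[h (X_u)] du`. -/
def resolvent (P : Measure Ω) (X : ℝ≥0 → Ω → ℝ) (c : ℝ) (h : ℝ → ℝ≥0∞) : ℝ≥0∞ :=
  ∫⁻ u in Ioi (0 : ℝ), ENNReal.ofReal (Real.exp (-c * u)) * ∫⁻ ω, h (X u.toNNReal ω) ∂P

theorem discount_mul_lintegral (c : ℝ) {S : ℝ≥0∞} (hS : S < ⊤) (F : ℝ≥0 → ℝ≥0∞) :
    discount c S * ∫⁻ u in Ioi (0 : ℝ),
      ENNReal.ofReal (Real.exp (-c * u)) * F (S.toNNReal + u.toNNReal) =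
    ∫⁻ r in Ioi S.toReal, ENNReal.ofReal (Real.exp (-c * r)) * F r.toNNReal := by
  rw [discount, if_pos hS, ← lintegral_const_mul' _ _ ENNReal.ofReal_ne_top,
    ← lintegral_indicator measurableSet_Ioi, ← lintegral_indicator measurableSet_Ioi]
  conv_rhs => rw [← lintegral_add_right_eq_self _ S.toReal]
  refine lintegral_congr fun u => ?_
  by_cases hu : 0 < u
  · rw [indicator_of_mem (by exact hu), indicator_of_mem (by simpa using hu), ← mul_assoc,
      ← ENNReal.ofReal_mul (Real.exp_nonneg _), ← Real.exp_add,
      Real.toNNReal_add hu.le ENNReal.toReal_nonneg, add_comm u.toNNReal]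
    congr 3
    · ring_nf
    · rw [ENNReal.toReal, Real.toNNReal_coe]
  · rw [indicator_of_notMem (by exact hu), indicator_of_notMem (by simpa using hu)]

theorem measurable_resolvent_integrand (hX : IsSpectrallyNegative ℱ P X) [SFinite P]
    {h : ℝ → ℝ≥0∞} (hh : Measurable h) :
    Measurable fun u : ℝ => ∫⁻ ω, h (jointVersion X (u.toNNReal, ω)) ∂P := by
  have hJ := measurable_jointVersion hX.measurable
  refine Measurable.lintegral_prod_right' (ν := P)
    (f := fun p : ℝ × Ω => h (jointVersion X (p.1.toNNReal, p.2))) ?_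
  exact hh.comp (hJ.comp ((measurable_real_toNNReal.comp measurable_fst).prodMk measurable_snd))

theorem IsSpectrallyNegative.lintegral_jointVersion (hX : IsSpectrallyNegative ℱ P X)
    (h : ℝ → ℝ≥0∞) (t : ℝ≥0) :
    ∫⁻ ω, h (jointVersion X (t, ω)) ∂P = ∫⁻ ω, h (X t ω) ∂P := by
  refine lintegral_congr_ae ?_
  filter_upwards [hX.path] with ω hω
  rw [hω.jointVersion_eq]

/-- The strong Markov property at an optional time, for the resolvent. -/
theorem IsSpectrallyNegative.strongMarkov_resolvent [IsProbabilityMeasure P]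
    (hX : IsSpectrallyNegative ℱ P X)
    (hS : IsOptionalTime ℱ S) (hW : IsKnownAt ℱ S W) (hW1 : ∀ ω, W ω ≤ 1)
    {c : ℝ} (hc : 0 ≤ c) {h : ℝ → ℝ≥0∞} (hh : Measurable h) :
    ∫⁻ ω, W ω * discount c (S ω) * (∫⁻ u in Ioi (0 : ℝ), ENNReal.ofReal (Real.exp (-c * u)) *
      h (jointVersion X ((S ω).toNNReal + u.toNNReal, ω) -
        jointVersion X ((S ω).toNNReal, ω))) ∂P =
      (∫⁻ ω, W ω * discount c (S ω) ∂P) * resolvent P X c h := by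
  set V : Ω → ℝ≥0∞ := fun ω => W ω * discount c (S ω) with hV
  have hVk : IsKnownAt ℱ S V := hW.mul (hS.isKnownAt_comp (measurable_discount c))
  have hV1 : ∀ ω, V ω ≤ 1 := fun ω => mul_le_one' (hW1 ω) (discount_le_one hc _)
  have hV0 : ∀ ω, S ω = ⊤ → V ω = 0 := fun ω hω => by simp [hV, hω]
  have hVm : Measurable V := hVk.measurable hV0
  have hJ := measurable_jointVersion hX.measurable
  have hSm : Measurable fun ω => (S ω).toNNReal := hS.measurable.ennreal_toNNReal
  have hD : Measurable fun p : Ω × ℝ => ENNReal.ofReal (Real.exp (-c * p.2)) *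
      h (jointVersion X ((S p.1).toNNReal + p.2.toNNReal, p.1) -
        jointVersion X ((S p.1).toNNReal, p.1)) := by
    refine Measurable.mul (by fun_prop) (hh.comp (Measurable.sub ?_ ?_))
    · exact hJ.comp (((hSm.comp measurable_fst).add
        (measurable_real_toNNReal.comp measurable_snd)).prodMk measurable_fst)
    · exact hJ.comp ((hSm.comp measurable_fst).prodMk measurable_fst)
  calc _ = ∫⁻ ω, (∫⁻ u in Ioi (0 : ℝ), V ω * (ENNReal.ofReal (Real.exp (-c * u)) *
      h (jointVersion X ((S ω).toNNReal + u.toNNReal, ω) -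
        jointVersion X ((S ω).toNNReal, ω)))) ∂P := by
        refine lintegral_congr fun ω => ?_
        rw [lintegral_const_mul' _ _ (ne_top_of_le_ne_top ENNReal.one_ne_top (hV1 ω))]
    _ = ∫⁻ u in Ioi (0 : ℝ), ∫⁻ ω, V ω * (ENNReal.ofReal (Real.exp (-c * u)) *
      h (jointVersion X ((S ω).toNNReal + u.toNNReal, ω) -
        jointVersion X ((S ω).toNNReal, ω))) ∂P := by
        refine lintegral_lintegral_swap (Measurable.aemeasurable ?_)
        exact (hVm.comp measurable_fst).mul hD
    _ = ∫⁻ u in Ioi (0 : ℝ), (∫⁻ ω, V ω ∂P) * (ENNReal.ofReal (Real.exp (-c * u)) *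
        ∫⁻ ω, h (X u.toNNReal ω) ∂P) := by
        refine lintegral_congr fun u => ?_
        rw [mul_left_comm, ← hX.strongMarkov hS hVk hV1 hV0 _ hh,
          ← lintegral_const_mul' _ _ ENNReal.ofReal_ne_top]
        exact lintegral_congr fun ω => mul_left_comm _ _ _
    _ = _ := by
        rw [lintegral_const_mul' _ _
          (ne_top_of_le_ne_top (by simp) (lintegral_mono (μ := P) (g := fun _ => 1) hV1))]
        rfl

/-- Almost surely, the time integral after `S` started at discount factor `exp (-c S)`. -/
theorem IsSpectrallyNegative.lintegral_after [IsProbabilityMeasure P]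
    (hX : IsSpectrallyNegative ℱ P X)
    (hS : IsOptionalTime ℱ S) (hW : IsKnownAt ℱ S W) (hW1 : ∀ ω, W ω ≤ 1)
    {c : ℝ} (hc : 0 ≤ c) {h : ℝ → ℝ≥0∞} (hh : Measurable h) :
    ∫⁻ ω, (if S ω < ⊤ then W ω * ∫⁻ r in Ioi (S ω).toReal, ENNReal.ofReal (Real.exp (-c * r)) *
      h (X r.toNNReal ω - X (S ω).toNNReal ω) else 0) ∂P =
      (∫⁻ ω, W ω * discount c (S ω) ∂P) * resolvent P X c h := by
  rw [← hX.strongMarkov_resolvent hS hW hW1 hc hh]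
  refine lintegral_congr_ae ?_
  filter_upwards [hX.path] with ω hω
  simp only [hω.jointVersion_eq]
  split_ifs with hS'
  · rw [mul_assoc, ← discount_mul_lintegral c hS' fun t => h (X t ω - X (S ω).toNNReal ω)]
  · simp [not_lt_top_iff.1 hS']

end Resolvent

/-! ### Laplace exponents -/

/-- `θ` is the Laplace exponent of `X`, and `Φ` is the inverse of `θ` to the right of its
only positive root `Φ 0`. -/
structure IsLaplaceExponent {Ω : Type*} {m : MeasurableSpace Ω} (P : Measure Ω)
    (X : ℝ≥0 → Ω → ℝ) (θ Φ : ℝ → ℝ) : Prop where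
  laplace : ∀ z : ℝ, 0 ≤ z → ∀ t : ℝ≥0,
    ∫ ω, Real.exp (z * X t ω) ∂P = Real.exp ((t : ℝ) * θ z)
  inverse_pos : ∀ a, 0 ≤ a → 0 < Φ a
  apply_inverse : ∀ a, 0 ≤ a → θ (Φ a) = a
  inverse_mono : StrictMonoOn Φ (Ici 0)
  root_unique : ∀ z, 0 < z → θ z = 0 → z = Φ 0

namespace IsLaplaceExponent

variable {Ω : Type*} {m : MeasurableSpace Ω} {P : Measure Ω}
  {X : ℝ≥0 → Ω → ℝ} {θ Φ : ℝ → ℝ}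

theorem integrable_exp (h : IsLaplaceExponent P X θ Φ) {z : ℝ} (hz : 0 ≤ z) (t : ℝ≥0) :
    Integrable (fun ω => Real.exp (z * X t ω)) P := by
  by_contra hn
  have := h.laplace z hz t
  rw [integral_undef hn] at this
  exact (Real.exp_pos _).ne this

theorem lintegral_exp (h : IsLaplaceExponent P X θ Φ) {z : ℝ} (hz : 0 ≤ z) (t : ℝ≥0) :
    ∫⁻ ω, ENNReal.ofReal (Real.exp (z * X t ω)) ∂P = ENNReal.ofReal (Real.exp (t * θ z)) := by
  rw [← h.laplace z hz t, ofReal_integral_eq_lintegral_ofReal (h.integrable_exp hz t)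
    (Eventually.of_forall fun ω => Real.exp_nonneg _)]

theorem apply_zero [IsProbabilityMeasure P] (h : IsLaplaceExponent P X θ Φ) : θ 0 = 0 := by
  have := h.laplace 0 le_rfl 1
  simpa using this.symm

theorem convexOn (h : IsLaplaceExponent P X θ Φ) : ConvexOn ℝ (Ici 0) θ := by
  refine ⟨convex_Ici 0, fun z hz w hw a b ha hb hab => ?_⟩
  simp only [smul_eq_mul]
  have hz' : 0 ≤ z := hz
  have hw' : 0 ≤ w := hw
  have hzw : 0 ≤ a * z + b * w := by positivity
  have e1 := h.laplace z hz 1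
  have e2 := h.laplace w hw 1
  have e3 := h.laplace _ hzw 1
  have i1 := h.integrable_exp hz 1
  have i2 := h.integrable_exp hw 1
  have i3 := h.integrable_exp hzw 1
  simp only [NNReal.coe_one, one_mul] at e1 e2 e3
  have key : ∫ ω, Real.exp (-(a * θ z + b * θ w)) * Real.exp ((a * z + b * w) * X 1 ω) ∂P ≤
      ∫ ω, (a * Real.exp (-θ z) * Real.exp (z * X 1 ω) +
        b * Real.exp (-θ w) * Real.exp (w * X 1 ω)) ∂P := by
    refine integral_mono (i3.const_mul _) ((i1.const_mul _).add (i2.const_mul _)) fun ω => ?_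
    have := convexOn_exp.2 (mem_univ (z * X 1 ω - θ z)) (mem_univ (w * X 1 ω - θ w)) ha hb hab
    simp only [smul_eq_mul] at this
    simp only [mul_assoc, ← Real.exp_add]
    refine (le_of_eq ?_).trans (this.trans (le_of_eq ?_))
    · ring_nf
    · ring_nf
  rw [integral_const_mul, integral_add (i1.const_mul _) (i2.const_mul _), integral_const_mul,
    integral_const_mul, e1, e2, e3, mul_assoc, mul_assoc, ← Real.exp_add, ← Real.exp_add,
    ← Real.exp_add] at key
  simp only [neg_add_cancel, Real.exp_zero, mul_one, hab] at key
  have := Real.exp_le_one_iff.1 key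
  linarith

theorem lt_of_lt_inverse [IsProbabilityMeasure P] (h : IsLaplaceExponent P X θ Φ) {c z : ℝ}
    (hc : 0 < c) (hz : 0 ≤ z) (hz' : z < Φ c) : θ z < c := by
  have hΦ := h.inverse_pos c hc.le
  have := h.convexOn.2 (mem_Ici.2 le_rfl) (mem_Ici.2 hΦ.le)
    (show 0 ≤ 1 - z / Φ c by rw [sub_nonneg, div_le_one hΦ]; exact hz'.le)
    (show 0 ≤ z / Φ c by positivity) (by ring)
  simp only [smul_eq_mul, mul_zero, zero_add, h.apply_zero, h.apply_inverse c hc.le,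
    div_mul_cancel₀ _ hΦ.ne'] at this
  have h2 : z / Φ c < 1 := (div_lt_one hΦ).2 hz'
  nlinarith

theorem differentiableAt (h : IsLaplaceExponent P X θ Φ) {z : ℝ} (hz : 0 < z) :
    DifferentiableAt ℝ θ z := by
  have hsub : Ioi (0 : ℝ) ⊆ interior (integrableExpSet (X 1) P) :=
    interior_maximal (fun w hw => h.integrable_exp (le_of_lt hw) 1) isOpen_Ioi
  refine (analyticAt_cgf (hsub hz)).differentiableAt.congr_of_eventuallyEq ?_
  filter_upwards [Ioi_mem_nhds hz] with w hw
  have := h.laplace w (le_of_lt hw) 1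
  simp only [NNReal.coe_one, one_mul] at this
  rw [cgf, mgf, this, Real.log_exp]

theorem pos_of_root_lt [IsProbabilityMeasure P] (h : IsLaplaceExponent P X θ Φ) {z : ℝ}
    (hz : Φ 0 < z) : 0 < θ z := by
  have hΦ := h.inverse_pos 0 le_rfl
  have hz0 : 0 < z := hΦ.trans hz
  have h1 := h.convexOn.2 (mem_Ici.2 le_rfl) (mem_Ici.2 hz0.le)
    (show 0 ≤ 1 - Φ 0 / z by rw [sub_nonneg, div_le_one hz0]; exact hz.le)
    (show 0 ≤ Φ 0 / z by positivity) (by ring)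
  simp only [smul_eq_mul, mul_zero, zero_add, h.apply_zero, div_mul_cancel₀ _ hz0.ne',
    h.apply_inverse 0 le_rfl] at h1
  have h2 : 0 ≤ θ z := nonneg_of_mul_nonneg_right h1 (by positivity)
  exact lt_of_le_of_ne h2 fun he => hz.ne' (h.root_unique z hz0 he.symm)

theorem strictMonoOn [IsProbabilityMeasure P] (h : IsLaplaceExponent P X θ Φ) :
    StrictMonoOn θ (Ici (Φ 0)) := by
  intro z hz w hw hzw
  have hΦ := h.inverse_pos 0 le_rfl
  have hz' : Φ 0 ≤ z := hz
  have hd : 0 < w - Φ 0 := by linarith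
  have hpos : 0 < θ w := h.pos_of_root_lt (hz'.trans_lt hzw)
  have h1 := h.convexOn.2 (mem_Ici.2 hΦ.le) (mem_Ici.2 (show 0 ≤ w by linarith))
    (show 0 ≤ (w - z) / (w - Φ 0) from div_nonneg (by linarith) hd.le)
    (show 0 ≤ (z - Φ 0) / (w - Φ 0) from div_nonneg (by linarith) hd.le) (by field_simp; ring)
  simp only [smul_eq_mul, h.apply_inverse 0 le_rfl, mul_zero, zero_add] at h1
  have h2 : (w - z) / (w - Φ 0) * Φ 0 + (z - Φ 0) / (w - Φ 0) * w = z := by field_simp; ring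
  rw [h2] at h1
  have h3 : (z - Φ 0) / (w - Φ 0) < 1 := (div_lt_one hd).2 (by linarith)
  nlinarith

theorem root_le_inverse (h : IsLaplaceExponent P X θ Φ) {a : ℝ} (ha : 0 ≤ a) : Φ 0 ≤ Φ a :=
  h.inverse_mono.monotoneOn (mem_Ici.2 le_rfl) ha ha

theorem inverse_apply [IsProbabilityMeasure P] (h : IsLaplaceExponent P X θ Φ) {z : ℝ}
    (hz : Φ 0 ≤ z) : Φ (θ z) = z := by
  have h0 : 0 ≤ θ z := by
    rcases hz.eq_or_lt with rfl | hlt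
    · exact (h.apply_inverse 0 le_rfl).ge
    · exact (h.pos_of_root_lt hlt).le
  exact h.strictMonoOn.injOn (h.root_le_inverse h0) hz (h.apply_inverse _ h0)

theorem resolvent_exp (h : IsLaplaceExponent P X θ Φ) {c z : ℝ} (hz : 0 ≤ z) (hzc : θ z < c) :
    resolvent P X c (fun x => ENNReal.ofReal (Real.exp (z * x))) =
      ENNReal.ofReal (1 / (c - θ z)) := by
  unfold resolvent
  simp_rw [h.lintegral_exp hz, ← ENNReal.ofReal_mul (Real.exp_nonneg _), ← Real.exp_add]
  have e : ∀ u ∈ Ioi (0 : ℝ), ENNReal.ofReal (Real.exp (-c * u + (u.toNNReal : ℝ) * θ z)) =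
      ENNReal.ofReal (Real.exp (-(c - θ z) * u)) := fun u hu => by
    rw [Real.coe_toNNReal u (le_of_lt hu)]
    ring_nf
  rw [setLIntegral_congr_fun measurableSet_Ioi e, ← ofReal_integral_eq_lintegral_ofReal
    (exp_neg_integrableOn_Ioi _ (sub_pos.2 hzc)) (Eventually.of_forall fun u => Real.exp_nonneg _),
    integral_exp_mul_Ioi (by linarith)]
  rw [mul_zero, Real.exp_zero, neg_div_neg_eq]

end IsLaplaceExponent

/-! ### Comparison of discounted passage times -/

section Comparison

variable {Ω : Type*} {m : MeasurableSpace Ω} {ℱ : Filtration ℝ≥0 m} {P : Measure Ω}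
  {X : ℝ≥0 → Ω → ℝ} {S T W : Ω → ℝ≥0∞} {θ Φ : ℝ → ℝ}

/-- The expected discount `E[W exp (-c S); S < ∞]`. -/
def discounted (P : Measure Ω) (W : Ω → ℝ≥0∞) (c : ℝ) (S : Ω → ℝ≥0∞) : ℝ≥0∞ :=
  ∫⁻ ω, W ω * discount c (S ω) ∂P

theorem measurable_mul_discount (hS : IsOptionalTime ℱ S) (hW : IsKnownAt ℱ S W) (c : ℝ) :
    Measurable fun ω => W ω * discount c (S ω) :=
  (hW.mul (hS.isKnownAt_comp (measurable_discount c))).measurable fun ω hω => by simp [hω]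

theorem tendsto_discounted [IsProbabilityMeasure P] (hS : IsOptionalTime ℱ S)
    (hW : IsKnownAt ℱ S W) (hW1 : ∀ ω, W ω ≤ 1) {ι : Type*} {l : Filter ι}
    [l.IsCountablyGenerated] {c : ι → ℝ} {c₀ : ℝ} (hc : ∀ᶠ i in l, 0 ≤ c i)
    (hc₀ : Tendsto c l (𝓝 c₀)) :
    Tendsto (fun i => discounted P W (c i) S) l (𝓝 (discounted P W c₀ S)) := by
  refine tendsto_lintegral_filter_of_dominated_convergence (fun _ => 1)
    (Eventually.of_forall fun i => measurable_mul_discount hS hW _) ?_ (by simp) ?_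
  · filter_upwards [hc] with i hi
    exact Eventually.of_forall fun ω => mul_le_one' (hW1 ω) (discount_le_one hi _)
  · refine Eventually.of_forall fun ω => ENNReal.Tendsto.const_mul ?_
      (Or.inr (ne_top_of_le_ne_top ENNReal.one_ne_top (hW1 ω)))
    unfold discount
    split_ifs
    · refine (ENNReal.continuous_ofReal.tendsto _).comp ((Real.continuous_exp.tendsto _).comp ?_)
      exact hc₀.neg.mul_const _
    · exact tendsto_const_nhds

theorem discounted_le_one [IsProbabilityMeasure P] (hW1 : ∀ ω, W ω ≤ 1) {c : ℝ} (hc : 0 ≤ c) :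
    discounted P W c S ≤ 1 := by
  refine (lintegral_mono (g := fun _ => 1) fun ω =>
    mul_le_one' (hW1 ω) (discount_le_one hc _)).trans (by simp)

theorem lintegral_exp_neg {c : ℝ} (hc : 0 < c) :
    ∫⁻ u in Ioi (0 : ℝ), ENNReal.ofReal (Real.exp (-c * u)) = ENNReal.ofReal (1 / c) := by
  rw [← ofReal_integral_eq_lintegral_ofReal (exp_neg_integrableOn_Ioi _ hc)
    (Eventually.of_forall fun u => Real.exp_nonneg _), integral_exp_mul_Ioi (by linarith),
    mul_zero, Real.exp_zero, neg_div_neg_eq]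

theorem measurable_ofReal_exp_mul (z : ℝ) :
    Measurable fun x : ℝ => ENNReal.ofReal (Real.exp (z * x)) := by fun_prop

/-- `X_T ≥ X_S + y` makes the discount at `T` smaller by the factor `exp (-Φ(c) y)`,
for `c > 0`. -/
theorem IsLaplaceExponent.discounted_le_of_pos [IsProbabilityMeasure P]
    (h : IsLaplaceExponent P X θ Φ)
    (hX : IsSpectrallyNegative ℱ P X) (hS : IsOptionalTime ℱ S) (hT : IsOptionalTime ℱ T)
    (hST : ∀ ω, S ω ≤ T ω) (hW : IsKnownAt ℱ S W) (hW1 : ∀ ω, W ω ≤ 1) {y : ℝ}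
    (hy : ∀ᵐ ω ∂P, T ω < ⊤ → X (S ω).toNNReal ω + y ≤ X (T ω).toNNReal ω) {c : ℝ}
    (hc : 0 < c) :
    ENNReal.ofReal (Real.exp (Φ c * y)) * discounted P W c T ≤ discounted P W c S := by
  have key : ∀ z ∈ Ico 0 (Φ c),
      ENNReal.ofReal (Real.exp (z * y)) * discounted P W c T ≤ discounted P W c S := by
    intro z hz
    have hzc := h.lt_of_lt_inverse hc hz.1 hz.2
    have hH : ENNReal.ofReal (1 / (c - θ z)) ≠ 0 := by
      simpa using hzc
    rw [← ENNReal.mul_le_mul_iff_left hH ENNReal.ofReal_ne_top, mul_assoc,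
      ← h.resolvent_exp hz.1 hzc]
    unfold discounted
    rw [← hX.lintegral_after hS hW hW1 hc.le (measurable_ofReal_exp_mul z),
      ← hX.lintegral_after hT (hW.mono hT hST) hW1 hc.le (measurable_ofReal_exp_mul z),
      ← lintegral_const_mul' _ _ ENNReal.ofReal_ne_top]
    refine lintegral_mono_ae ?_
    filter_upwards [hy] with ω hω
    by_cases hTω : T ω < ⊤
    · rw [if_pos hTω, if_pos ((hST ω).trans_lt hTω), mul_left_comm,
        ← lintegral_const_mul' _ _ ENNReal.ofReal_ne_top]
      refine mul_le_mul_right ?_ _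
      refine (lintegral_mono fun r => ?_).trans
        (lintegral_mono_set (Ioi_subset_Ioi (ENNReal.toReal_mono hTω.ne (hST ω))))
      rw [mul_left_comm, ← ENNReal.ofReal_mul (Real.exp_nonneg _), ← Real.exp_add]
      gcongr
      nlinarith [hω hTω, hz.1]
    · simp [hTω]
  refine le_of_tendsto (x := 𝓝[<] (Φ c)) (ENNReal.Tendsto.mul_const ?_
    (Or.inr (ne_top_of_le_ne_top ENNReal.one_ne_top (discounted_le_one hW1 hc.le))))
    (Filter.mem_of_superset (Ico_mem_nhdsLT (h.inverse_pos c hc.le)) key)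
  have : Continuous fun z => ENNReal.ofReal (Real.exp (z * y)) :=
    ENNReal.continuous_ofReal.comp (by fun_prop)
  exact (this.tendsto _).mono_left nhdsWithin_le_nhds

/-- `X ≤ X_S + y` on `[S, T]` makes the discount at `T` at least `exp (-Φ(c) y)` times that
at `S`, for `c > 0`. -/
theorem IsLaplaceExponent.le_discounted_of_pos [IsProbabilityMeasure P]
    (h : IsLaplaceExponent P X θ Φ)
    (hX : IsSpectrallyNegative ℱ P X) (hS : IsOptionalTime ℱ S) (hT : IsOptionalTime ℱ T)
    (hST : ∀ ω, S ω ≤ T ω) (hW : IsKnownAt ℱ S W) (hW1 : ∀ ω, W ω ≤ 1) {y : ℝ}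
    (hbefore : ∀ᵐ ω ∂P, ∀ r : ℝ≥0, S ω ≤ r → r < T ω → X r ω ≤ X (S ω).toNNReal ω + y)
    (hy : ∀ᵐ ω ∂P, T ω < ⊤ → X (T ω).toNNReal ω ≤ X (S ω).toNNReal ω + y) {c : ℝ}
    (hc : 0 < c) :
    discounted P W c S ≤ ENNReal.ofReal (Real.exp (Φ c * y)) * discounted P W c T := by
  have key : ∀ z ∈ Ico 0 (Φ c), discounted P W c S ≤
      ENNReal.ofReal (Real.exp (z * y) * (1 / c) * (c - θ z)) +
        ENNReal.ofReal (Real.exp (z * y)) * discounted P W c T := by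
    intro z hz
    have hzc := h.lt_of_lt_inverse hc hz.1 hz.2
    have hH : ENNReal.ofReal (1 / (c - θ z)) ≠ 0 := by
      simpa using hzc
    have hcancel : ENNReal.ofReal (Real.exp (z * y) * (1 / c) * (c - θ z)) *
        ENNReal.ofReal (1 / (c - θ z)) =
          ENNReal.ofReal (Real.exp (z * y)) * ENNReal.ofReal (1 / c) := by
      rw [← ENNReal.ofReal_mul (by have := sub_pos.2 hzc; positivity),
        ← ENNReal.ofReal_mul (Real.exp_nonneg _)]
      have := (sub_pos.2 hzc).ne'
      congr 1
      field_simp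
    rw [← ENNReal.mul_le_mul_iff_left hH ENNReal.ofReal_ne_top, add_mul,
      mul_assoc (ENNReal.ofReal _) (discounted P W c T), hcancel,
      ← lintegral_exp_neg hc, ← h.resolvent_exp hz.1 hzc, ← mul_add]
    unfold discounted
    rw [← hX.lintegral_after hS hW hW1 hc.le (measurable_ofReal_exp_mul z),
      ← hX.lintegral_after hT (hW.mono hT hST) hW1 hc.le (measurable_ofReal_exp_mul z)]
    have hconst : ∫⁻ u in Ioi (0 : ℝ), ENNReal.ofReal (Real.exp (-c * u)) =
      ∫⁻ _, (∫⁻ u in Ioi (0 : ℝ), ENNReal.ofReal (Real.exp (-c * u))) ∂P := by simp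
    rw [hconst, ← lintegral_add_left measurable_const,
      ← lintegral_const_mul' _ _ ENNReal.ofReal_ne_top]
    refine lintegral_mono_ae ?_
    filter_upwards [hy, hbefore] with ω hω hω'
    by_cases hSω : S ω < ⊤
    swap
    · simp [hSω]
    rw [if_pos hSω]
    have hcover : Ioi (S ω).toReal ⊆ {r : ℝ | 0 < r ∧ S ω ≤ r.toNNReal ∧ r.toNNReal ≤ T ω} ∪
        (if T ω < ⊤ then Ioi (T ω).toReal else ∅) := by
      intro r hr
      have hr0 : 0 < r := ENNReal.toReal_nonneg.trans_lt hr
      by_cases hrT : (r.toNNReal : ℝ≥0∞) ≤ T ω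
      · refine Or.inl ⟨hr0, ?_, hrT⟩
        exact (ENNReal.le_ofReal_iff_toReal_le hSω.ne hr0.le).2 (le_of_lt hr)
      · right
        have hT' : T ω < r.toNNReal := not_le.1 hrT
        rw [if_pos (hT'.trans ENNReal.coe_lt_top)]
        exact (ENNReal.lt_ofReal_iff_toReal_lt (hT'.trans ENNReal.coe_lt_top).ne).1 hT'
    have hA : MeasurableSet {r : ℝ | 0 < r ∧ S ω ≤ r.toNNReal ∧ r.toNNReal ≤ T ω} := by
      refine (measurableSet_Ioi (a := (0 : ℝ))).inter (MeasurableSet.inter ?_ ?_)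
      · exact measurableSet_le measurable_const ENNReal.measurable_ofReal
      · exact measurableSet_le ENNReal.measurable_ofReal measurable_const
    refine (mul_le_mul_right (lintegral_mono_set hcover) _).trans ?_
    refine (mul_le_mul_right (lintegral_union_le _ _ _) _).trans ?_
    rw [mul_add, mul_add]
    refine add_le_add ?_ ?_
    · rw [← lintegral_const_mul' _ _ ENNReal.ofReal_ne_top]
      refine (mul_le_of_le_one_left (zero_le) (hW1 ω)).trans ?_
      refine le_trans ?_ (lintegral_mono_set (s := {r : ℝ | 0 < r ∧ S ω ≤ r.toNNReal ∧
        r.toNNReal ≤ T ω}) fun r hr => hr.1)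
      refine setLIntegral_mono' hA fun r hr => ?_
      rw [mul_comm]
      gcongr
      · exact hz.1
      · have : X r.toNNReal ω ≤ X (S ω).toNNReal ω + y := by
          rcases hr.2.2.lt_or_eq with hlt | heq
          · exact hω' _ hr.2.1 hlt
          · have := hω (heq ▸ ENNReal.coe_lt_top)
            rwa [← heq, ENNReal.toNNReal_coe] at this
        linarith
    · split_ifs with hT'
      · rw [mul_left_comm, ← lintegral_const_mul' (ENNReal.ofReal _) _ ENNReal.ofReal_ne_top]
        refine mul_le_mul_right (lintegral_mono fun r => ?_) _
        rw [mul_left_comm, ← ENNReal.ofReal_mul (p := Real.exp (z * y)) (Real.exp_nonneg _),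
          ← Real.exp_add]
        gcongr
        nlinarith [hω hT', hz.1]
      · simp
  refine ge_of_tendsto (x := 𝓝[<] (Φ c)) ?_
    (Filter.mem_of_superset (Ico_mem_nhdsLT (h.inverse_pos c hc.le)) key)
  have h1 : Continuous fun z => ENNReal.ofReal (Real.exp (z * y)) :=
    ENNReal.continuous_ofReal.comp (by fun_prop)
  have h2 : ContinuousAt (fun z => ENNReal.ofReal (Real.exp (z * y) * (1 / c) * (c - θ z)))
      (Φ c) := by
    refine ENNReal.continuous_ofReal.continuousAt.comp ?_
    exact ContinuousAt.mul (by fun_prop) (continuousAt_const.sub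
      (h.differentiableAt (h.inverse_pos c hc.le)).continuousAt)
  have h3 := h2.tendsto
  rw [h.apply_inverse c hc.le, sub_self, mul_zero, ENNReal.ofReal_zero] at h3
  rw [← zero_add (ENNReal.ofReal (Real.exp (Φ c * y)) * _)]
  exact (h3.mono_left nhdsWithin_le_nhds).add (ENNReal.Tendsto.mul_const
    ((h1.tendsto _).mono_left nhdsWithin_le_nhds)
    (Or.inr (ne_top_of_le_ne_top ENNReal.one_ne_top (discounted_le_one hW1 hc.le))))

theorem IsLaplaceExponent.tendsto_exp_mul_discounted [IsProbabilityMeasure P]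
    (h : IsLaplaceExponent P X θ Φ) (hS : IsOptionalTime ℱ S)
    (hW : IsKnownAt ℱ S W) (hW1 : ∀ ω, W ω ≤ 1) (y : ℝ) :
    Tendsto (fun z => ENNReal.ofReal (Real.exp (z * y)) * discounted P W (θ z) S)
      (𝓝[>] (Φ 0)) (𝓝 (ENNReal.ofReal (Real.exp (Φ 0 * y)) * discounted P W 0 S)) := by
  have h1 : Continuous fun z => ENNReal.ofReal (Real.exp (z * y)) :=
    ENNReal.continuous_ofReal.comp (by fun_prop)
  have h2 := (h.differentiableAt (h.inverse_pos 0 le_rfl)).continuousAt.tendsto.mono_left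
    (nhdsWithin_le_nhds (s := Ioi (Φ 0)))
  rw [h.apply_inverse 0 le_rfl] at h2
  refine ENNReal.Tendsto.mul ((h1.tendsto _).mono_left nhdsWithin_le_nhds) (Or.inr ?_)
    (tendsto_discounted hS hW hW1 ?_ h2) (Or.inr ENNReal.ofReal_ne_top)
  · exact ne_top_of_le_ne_top ENNReal.one_ne_top (discounted_le_one hW1 le_rfl)
  · filter_upwards [self_mem_nhdsWithin] with z hz
    exact (h.pos_of_root_lt hz).le

theorem IsLaplaceExponent.discounted_le [IsProbabilityMeasure P]
    (h : IsLaplaceExponent P X θ Φ)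
    (hX : IsSpectrallyNegative ℱ P X) (hS : IsOptionalTime ℱ S) (hT : IsOptionalTime ℱ T)
    (hST : ∀ ω, S ω ≤ T ω) (hW : IsKnownAt ℱ S W) (hW1 : ∀ ω, W ω ≤ 1) {y : ℝ}
    (hy : ∀ᵐ ω ∂P, T ω < ⊤ → X (S ω).toNNReal ω + y ≤ X (T ω).toNNReal ω) {c : ℝ}
    (hc : 0 ≤ c) :
    ENNReal.ofReal (Real.exp (Φ c * y)) * discounted P W c T ≤ discounted P W c S := by
  rcases hc.eq_or_lt with rfl | hc
  · have h0 := h.tendsto_exp_mul_discounted hS hW hW1 0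
    simp only [mul_zero, Real.exp_zero, ENNReal.ofReal_one, one_mul] at h0
    refine le_of_tendsto_of_tendsto
      (h.tendsto_exp_mul_discounted hT (hW.mono hT hST) hW1 y) h0 ?_
    filter_upwards [self_mem_nhdsWithin] with z hz
    have := h.discounted_le_of_pos hX hS hT hST hW hW1 hy (h.pos_of_root_lt hz)
    rwa [h.inverse_apply (le_of_lt hz)] at this
  · exact h.discounted_le_of_pos hX hS hT hST hW hW1 hy hc

theorem IsLaplaceExponent.le_discounted [IsProbabilityMeasure P]
    (h : IsLaplaceExponent P X θ Φ)
    (hX : IsSpectrallyNegative ℱ P X) (hS : IsOptionalTime ℱ S) (hT : IsOptionalTime ℱ T)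
    (hST : ∀ ω, S ω ≤ T ω) (hW : IsKnownAt ℱ S W) (hW1 : ∀ ω, W ω ≤ 1) {y : ℝ}
    (hbefore : ∀ᵐ ω ∂P, ∀ r : ℝ≥0, S ω ≤ r → r < T ω → X r ω ≤ X (S ω).toNNReal ω + y)
    (hy : ∀ᵐ ω ∂P, T ω < ⊤ → X (T ω).toNNReal ω ≤ X (S ω).toNNReal ω + y) {c : ℝ}
    (hc : 0 ≤ c) :
    discounted P W c S ≤ ENNReal.ofReal (Real.exp (Φ c * y)) * discounted P W c T := by
  rcases hc.eq_or_lt with rfl | hc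
  · have h0 := h.tendsto_exp_mul_discounted hS hW hW1 0
    simp only [mul_zero, Real.exp_zero, ENNReal.ofReal_one, one_mul] at h0
    refine le_of_tendsto_of_tendsto h0
      (h.tendsto_exp_mul_discounted hT (hW.mono hT hST) hW1 y) ?_
    filter_upwards [self_mem_nhdsWithin] with z hz
    have := h.le_discounted_of_pos hX hS hT hST hW hW1 hbefore hy (h.pos_of_root_lt hz)
    rwa [h.inverse_apply (le_of_lt hz)] at this
  · exact h.le_discounted_of_pos hX hS hT hST hW hW1 hbefore hy hc

end Comparison

/-! ### First passage times above a level -/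

/-- The first passage time above the level `x`. -/
def firstPassage {Ω : Type*} (X : ℝ≥0 → Ω → ℝ) (x : ℝ) (ω : Ω) : ℝ≥0∞ :=
  passage (fun t => X t ω) 0 x

section FirstPassage

variable {Ω : Type*} {m : MeasurableSpace Ω} {ℱ : Filtration ℝ≥0 m} {P : Measure Ω}
  {X : ℝ≥0 → Ω → ℝ} {S T W : Ω → ℝ≥0∞} {θ Φ : ℝ → ℝ}

theorem firstPassage_mono (ω : Ω) : Monotone fun x => firstPassage X x ω :=
  fun _ _ h => passage_mono h

theorem measurable_firstPassage_prod (hX : ∀ t, Measurable (X t)) :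
    Measurable fun p : ℝ × Ω => firstPassage X p.1 p.2 := by
  unfold firstPassage passage
  refine Measurable.iInf fun s => Measurable.ite ?_ measurable_const measurable_const
  exact (MeasurableSet.const _).inter
    (measurableSet_lt measurable_fst ((hX _).comp measurable_snd))

theorem IsSpectrallyNegative.isOptionalTime_firstPassage (hX : IsSpectrallyNegative ℱ P X)
    (x : ℝ) : IsOptionalTime ℱ (firstPassage X x) :=
  isOptionalTime_passage hX.adapted measurable_const

theorem discount_mul_discount_zero (c : ℝ) (s : ℝ≥0∞) :
    discount c s * discount 0 s = discount c s := by
  unfold discount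
  split_ifs <;> simp

theorem discount_zero_eq_one {s : ℝ≥0∞} (h : s < ⊤) : discount 0 s = 1 := by
  simp [discount, h]

theorem lintegral_discount_zero {U : Ω → ℝ≥0∞} (hU : Measurable U) :
    ∫⁻ ω, discount 0 (U ω) ∂P = P {ω | U ω < ⊤} := by
  have hm : MeasurableSet {ω | U ω < ⊤} := hU measurableSet_Iio
  rw [← lintegral_indicator_one hm]
  refine lintegral_congr fun ω => ?_
  by_cases hω : U ω < ⊤
  · rw [indicator_of_mem (by exact hω), discount_zero_eq_one hω, Pi.one_apply]
  · rw [indicator_of_notMem (by exact hω), not_lt_top_iff.1 hω, discount_top]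

theorem ofReal_exp_mul_cancel {u : ℝ} {A B : ℝ≥0∞}
    (h : ENNReal.ofReal (Real.exp u) * A = B) : A = ENNReal.ofReal (Real.exp (-u)) * B := by
  rw [← h, ← mul_assoc, ← ENNReal.ofReal_mul (Real.exp_nonneg _), ← Real.exp_add,
    neg_add_cancel, Real.exp_zero, ENNReal.ofReal_one, one_mul]

variable [IsProbabilityMeasure P]

theorem IsLaplaceExponent.exp_mul_discounted_firstPassage (h : IsLaplaceExponent P X θ Φ)
    (hX : IsSpectrallyNegative ℱ P X) {x y c : ℝ} (hx : 0 ≤ x) (hy : 0 ≤ y) (hc : 0 ≤ c)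
    (hW : IsKnownAt ℱ (firstPassage X x) W) (hW1 : ∀ ω, W ω ≤ 1) :
    ENNReal.ofReal (Real.exp (Φ c * y)) * discounted P W c (firstPassage X (x + y)) =
      discounted P W c (firstPassage X x) := by
  have hxy : x ≤ x + y := le_add_of_nonneg_right hy
  have hle : ∀ ω, firstPassage X x ω ≤ firstPassage X (x + y) ω := fun ω => passage_mono hxy
  refine le_antisymm ?_ ?_
  · refine h.discounted_le hX (hX.isOptionalTime_firstPassage x)
      (hX.isOptionalTime_firstPassage _) hle hW hW1 ?_ hc
    filter_upwards [hX.path] with ω hω hT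
    have hS : firstPassage X x ω < ⊤ := (hle ω).trans_lt hT
    rw [firstPassage, firstPassage, hω.apply_passage (hω.zero.trans_le hx) hS]
    exact hω.le_apply_passage hT
  · refine h.le_discounted hX (hX.isOptionalTime_firstPassage x)
      (hX.isOptionalTime_firstPassage _) hle hW hW1 ?_ ?_ hc
    · filter_upwards [hX.path] with ω hω r hr hrT
      have hS : firstPassage X x ω < ⊤ := hr.trans_lt ENNReal.coe_lt_top
      rw [firstPassage, hω.apply_passage (hω.zero.trans_le hx) hS]
      exact hω.le_of_lt_passage zero_le hrT
    · filter_upwards [hX.path] with ω hω hT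
      have hS : firstPassage X x ω < ⊤ := (hle ω).trans_lt hT
      rw [firstPassage, firstPassage, hω.apply_passage (hω.zero.trans_le hx) hS]
      exact hω.apply_passage_le (hω.zero.trans_le (hx.trans hxy)) hT

/-- The Laplace transform of the first passage time above `x`. -/
theorem IsLaplaceExponent.lintegral_discount_firstPassage (h : IsLaplaceExponent P X θ Φ)
    (hX : IsSpectrallyNegative ℱ P X) {x c : ℝ} (hx : 0 ≤ x) (hc : 0 ≤ c) :
    ∫⁻ ω, discount c (firstPassage X x ω) ∂P = ENNReal.ofReal (Real.exp (-(Φ c * x))) := by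
  have hT := hX.isOptionalTime_firstPassage x
  have key : ENNReal.ofReal (Real.exp (Φ c * x)) * discounted P (fun _ => 1) c (firstPassage X x) =
      discounted P (fun _ => 1) c (fun _ => 0) := by
    refine le_antisymm ?_ ?_
    · refine h.discounted_le hX IsOptionalTime.zero hT (fun ω => zero_le)
        IsOptionalTime.zero.isKnownAt_one (fun _ => le_rfl) ?_ hc
      filter_upwards [hX.path] with ω hω hTω
      rw [ENNReal.toNNReal_zero, hω.zero, zero_add]
      exact hω.le_apply_passage hTω
    · refine h.le_discounted hX IsOptionalTime.zero hT (fun ω => zero_le)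
        IsOptionalTime.zero.isKnownAt_one (fun _ => le_rfl) ?_ ?_ hc
      · filter_upwards [hX.path] with ω hω r _ hrT
        rw [ENNReal.toNNReal_zero, hω.zero, zero_add]
        exact hω.le_of_lt_passage zero_le hrT
      · filter_upwards [hX.path] with ω hω hTω
        rw [ENNReal.toNNReal_zero, hω.zero, zero_add]
        exact hω.apply_passage_le (hω.zero.trans_le hx) hTω
  have := ofReal_exp_mul_cancel key
  simpa [discounted] using this

theorem IsLaplaceExponent.lintegral_discount_mul_discount (h : IsLaplaceExponent P X θ Φ)
    (hX : IsSpectrallyNegative ℱ P X) {x y a : ℝ} (hx : 0 ≤ x) (hy : 0 ≤ y) (ha : 0 ≤ a) :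
    ∫⁻ ω, discount a (firstPassage X x ω) * discount 0 (firstPassage X (x + y) ω) ∂P =
      ENNReal.ofReal (Real.exp (-(Φ 0 * y))) * ENNReal.ofReal (Real.exp (-(Φ a * x))) := by
  have hT := hX.isOptionalTime_firstPassage x
  have := ofReal_exp_mul_cancel (h.exp_mul_discounted_firstPassage hX hx hy le_rfl
    (hT.isKnownAt_comp (measurable_discount a)) fun ω => discount_le_one ha _)
  rw [← h.lintegral_discount_firstPassage hX hx ha]
  simpa only [discounted, discount_mul_discount_zero] using this

theorem IsLaplaceExponent.measure_firstPassage_lt_top (h : IsLaplaceExponent P X θ Φ)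
    (hX : IsSpectrallyNegative ℱ P X) {x : ℝ} (hx : 0 ≤ x) :
    P {ω | firstPassage X x ω < ⊤} = ENNReal.ofReal (Real.exp (-(Φ 0 * x))) := by
  rw [← h.lintegral_discount_firstPassage hX hx le_rfl,
    lintegral_discount_zero (hX.isOptionalTime_firstPassage x).measurable]

theorem IsLaplaceExponent.ae_bddAbove (h : IsLaplaceExponent P X θ Φ)
    (hX : IsSpectrallyNegative ℱ P X) : ∀ᵐ ω ∂P, BddAbove (range fun t => X t ω) := by
  have h1 : ∀ᵐ ω ∂P, ∃ n : ℕ, firstPassage X n ω = ⊤ := by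
    have hlim : Tendsto (fun n : ℕ => ENNReal.ofReal (Real.exp (-(Φ 0 * n)))) atTop (𝓝 0) := by
      rw [← ENNReal.ofReal_zero]
      refine (ENNReal.continuous_ofReal.tendsto _).comp
        (Real.tendsto_exp_neg_atTop_nhds_zero.comp ?_)
      exact tendsto_natCast_atTop_atTop.const_mul_atTop (h.inverse_pos 0 le_rfl)
    rw [ae_iff]
    refine le_antisymm (ge_of_tendsto' hlim fun n => ?_) zero_le
    rw [← h.measure_firstPassage_lt_top hX n.cast_nonneg]
    refine measure_mono fun ω hω => ?_
    exact lt_top_iff_ne_top.2 (not_exists.1 hω n)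
  filter_upwards [h1, hX.path] with ω ⟨n, hn⟩ hω
  refine ⟨n, ?_⟩
  rintro _ ⟨t, rfl⟩
  exact hω.le_of_lt_passage zero_le (ENNReal.coe_lt_top.trans_eq hn.symm)

theorem IsLaplaceExponent.ae_exists_pos (h : IsLaplaceExponent P X θ Φ)
    (hX : IsSpectrallyNegative ℱ P X) : ∀ᵐ ω ∂P, ∃ t, 0 < X t ω := by
  have h1 : ∀ᵐ ω ∂P, firstPassage X 0 ω < ⊤ := by
    refine (mem_ae_iff_prob_eq_one
      ((hX.isOptionalTime_firstPassage 0).measurable measurableSet_Iio)).2 ?_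
    exact (h.measure_firstPassage_lt_top hX le_rfl).trans (by simp)
  filter_upwards [h1] with ω hω
  obtain ⟨s, -, hs, -⟩ := passage_lt_iff.1 hω
  exact ⟨_, hs⟩

end FirstPassage

/-! ### The overall maximum of a path -/

section Maximum

variable {f : ℝ≥0 → ℝ}

theorem passage_zero_lt_top_iff (hf : IsRegularPath f) (hb : BddAbove (range f)) {x : ℝ} :
    passage f 0 x < ⊤ ↔ x < ⨆ t, f t := by
  rw [lt_ciSup_iff hb]
  constructor
  · intro h
    obtain ⟨s, -, hs, -⟩ := passage_lt_iff.1 h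
    exact ⟨_, hs⟩
  · rintro ⟨s, hs⟩
    exact hf.passage_lt zero_le hs ENNReal.coe_lt_top

/-- The running maximum of `f` along rational times. -/
def runningMax (f : ℝ≥0 → ℝ) (r : ℝ≥0) : ℝ := ⨆ s : ℚ, f (min r (Real.toNNReal s))

theorem bddAbove_runningMax (hb : BddAbove (range f)) (r : ℝ≥0) :
    BddAbove (range fun s : ℚ => f (min r (Real.toNNReal s))) :=
  hb.mono (by rintro _ ⟨s, rfl⟩; exact ⟨_, rfl⟩)

theorem apply_le_runningMax (hb : BddAbove (range f)) (r : ℝ≥0) : f r ≤ runningMax f r := by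
  obtain ⟨n, hn⟩ := exists_nat_ge r
  have : r ≤ Real.toNNReal (n : ℚ) := by simpa using hn
  refine (le_of_eq ?_).trans (le_ciSup (bddAbove_runningMax hb r) (n : ℚ))
  rw [min_eq_left this]

theorem measurable_runningMax {Ω : Type*} {m : MeasurableSpace Ω} {ℱ : Filtration ℝ≥0 m}
    {X : ℝ≥0 → Ω → ℝ} (hX : ∀ t, Measurable[ℱ t] (X t)) (r : ℝ≥0) :
    Measurable[ℱ r] fun ω => runningMax (fun t => X t ω) r :=
  Measurable.iSup (mδ := ℱ r) fun _ => (hX _).mono (ℱ.mono (min_le_left _ _)) le_rfl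

/-- If `f` does not come back to its running maximum in the limit without exceeding it, then it is
at its overall maximum only once, and this time is the limit of passage times. -/
theorem IsRegularPath.tendsto_passage (hf : IsRegularPath f) (hb : BddAbove (range f))
    (hback : ∀ r : ℚ, passage f (Real.toNNReal r) (runningMax f (Real.toNNReal r)) = ⊤ →
      ∃ n : ℕ, passage f (Real.toNNReal r) (runningMax f (Real.toNNReal r) - 1 / (n + 1)) = ⊤)
    {t : ℝ≥0} (ht : f t = ⨆ s, f s) :
    Tendsto (fun n : ℕ => passage f 0 ((⨆ s, f s) - 1 / (n + 1))) atTop (𝓝 t) := by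
  set M := ⨆ s, f s with hM
  have hle : ∀ n : ℕ, passage f 0 (M - 1 / (n + 1)) ≤ t := fun n =>
    hf.passage_le zero_le (by rw [ht]; exact sub_lt_self _ (by positivity))
  refine tendsto_order.2 ⟨fun a ha => ?_, fun a ha => Eventually.of_forall fun n =>
    (hle n).trans_lt ha⟩
  by_contra hcon
  have hall : ∀ n : ℕ, passage f 0 (M - 1 / (n + 1)) ≤ a := by
    intro n
    by_contra hn
    refine hcon (eventually_atTop.2 ⟨n, fun k hk => (not_le.1 hn).trans_le (passage_mono ?_)⟩)
    have : (1 : ℝ) / (k + 1) ≤ 1 / (n + 1) := Nat.one_div_le_one_div hk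
    linarith
  lift a to ℝ≥0 using (ha.trans ENNReal.coe_lt_top).ne
  obtain ⟨r, -, hr1, hr2⟩ := NNReal.lt_iff_exists_rat_btwn _ _ |>.1 (ENNReal.coe_lt_coe.1 ha)
  set R := Real.toNNReal r
  have hMle : M ≤ runningMax f R := by
    refine le_of_forall_pos_le_add fun ε hε => ?_
    obtain ⟨n, hn⟩ := exists_nat_one_div_lt hε
    obtain ⟨s, -, hs, hs'⟩ := passage_lt_iff.1 ((hall n).trans_lt (ENNReal.coe_lt_coe.2 hr1))
    have h1 := le_ciSup (bddAbove_runningMax hb R) s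
    simp only [min_eq_right (ENNReal.coe_lt_coe.1 hs').le] at h1
    change M ≤ (⨆ s : ℚ, f (min R (Real.toNNReal s))) + ε
    linarith
  have hMeq : runningMax f R = M :=
    le_antisymm (ciSup_le fun s => le_ciSup hb _) hMle
  have h1 : passage f R M = ⊤ := by
    by_contra h
    obtain ⟨s, -, hs, -⟩ := passage_lt_iff.1 (lt_top_iff_ne_top.2 h)
    exact absurd (le_ciSup hb _) (not_le.2 hs)
  obtain ⟨n, hn⟩ := hback r (by rw [hMeq]; exact h1)
  have h2 : passage f R (M - 1 / (n + 1)) < ⊤ :=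
    hf.passage_lt hr2.le (by rw [ht]; exact sub_lt_self _ (by positivity)) ENNReal.coe_lt_top
  rw [hMeq] at hn
  exact h2.ne hn

end Maximum

/-- Almost surely, after any rational time the path either exceeds its running maximum or stays
away from it. -/
theorem IsLaplaceExponent.ae_back {Ω : Type*} {m : MeasurableSpace Ω} {ℱ : Filtration ℝ≥0 m}
    {P : Measure Ω} [IsProbabilityMeasure P] {X : ℝ≥0 → Ω → ℝ} {θ Φ : ℝ → ℝ}
    (h : IsLaplaceExponent P X θ Φ) (hX : IsSpectrallyNegative ℱ P X) (r : ℝ≥0) :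
    ∀ᵐ ω ∂P, passage (fun t => X t ω) r (runningMax (fun t => X t ω) r) = ⊤ →
      ∃ n : ℕ, passage (fun t => X t ω) r
        (runningMax (fun t => X t ω) r - 1 / (n + 1)) = ⊤ := by
  set L : Ω → ℝ := fun ω => runningMax (fun t => X t ω) r
  have hL : Measurable[ℱ r] L := measurable_runningMax hX.adapted r
  set T : Ω → ℝ≥0∞ := fun ω => passage (fun t => X t ω) r (L ω)
  set S : ℕ → Ω → ℝ≥0∞ := fun n ω => passage (fun t => X t ω) r (L ω - 1 / (n + 1))
  have hT : IsOptionalTime ℱ T := isOptionalTime_passage hX.adapted hL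
  have hS : ∀ n, IsOptionalTime ℱ (S n) := fun n =>
    isOptionalTime_passage hX.adapted (hL.sub_const _)
  have hpos : ∀ n : ℕ, (0 : ℝ) < 1 / (n + 1) := fun n => Nat.one_div_pos_of_nat
  have hST : ∀ n ω, S n ω ≤ T ω := fun n ω => passage_mono (sub_le_self _ (hpos n).le)
  have hcomp : ∀ n : ℕ, discounted P (fun _ => 1) 0 (S n) ≤
      ENNReal.ofReal (Real.exp (Φ 0 * (1 / (n + 1)))) * discounted P (fun _ => 1) 0 T := by
    intro n
    refine h.le_discounted hX (hS n) hT (hST n) (hS n).isKnownAt_one (fun _ => le_rfl) ?_ ?_ le_rfl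
    · filter_upwards [hX.path] with ω hω u hu huT
      have h1 : L ω - 1 / (n + 1) ≤ X (S n ω).toNNReal ω :=
        hω.le_apply_passage (hu.trans_lt ENNReal.coe_lt_top)
      have hru : r ≤ u := ENNReal.coe_le_coe.1 (le_passage.trans hu)
      have h2 : X u ω ≤ L ω := hω.le_of_lt_passage hru huT
      linarith
    · filter_upwards [hX.path, h.ae_bddAbove hX] with ω hω hb hTω
      have h1 : L ω - 1 / (n + 1) ≤ X (S n ω).toNNReal ω :=
        hω.le_apply_passage ((hST n ω).trans_lt hTω)
      have h2 : X (T ω).toNNReal ω ≤ L ω :=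
        hω.apply_passage_le (apply_le_runningMax hb r) hTω
      linarith
  have hprob : ∀ {U : Ω → ℝ≥0∞}, IsOptionalTime ℱ U →
      discounted P (fun _ => 1) 0 U = P {ω | U ω < ⊤} := by
    intro U hU
    simpa only [discounted, one_mul] using lintegral_discount_zero hU.measurable
  have hlim : Tendsto (fun n : ℕ => ENNReal.ofReal (Real.exp (Φ 0 * (1 / ((n : ℝ) + 1)))) *
      discounted P (fun _ => 1) 0 T) atTop (𝓝 (P {ω | T ω < ⊤})) := by
    have h1 : Tendsto (fun n : ℕ => Φ 0 * (1 / ((n : ℝ) + 1))) atTop (𝓝 0) := by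
      simpa using tendsto_one_div_add_atTop_nhds_zero_nat.const_mul (Φ 0)
    have h2 := (ENNReal.continuous_ofReal.tendsto _).comp ((Real.continuous_exp.tendsto _).comp h1)
    rw [Real.exp_zero, ENNReal.ofReal_one] at h2
    rw [hprob hT]
    simpa using ENNReal.Tendsto.mul_const h2 (Or.inr (measure_ne_top P {ω | T ω < ⊤}))
  have hle : P (⋂ n, {ω | S n ω < ⊤}) ≤ P {ω | T ω < ⊤} :=
    ge_of_tendsto' hlim fun n => (measure_mono (iInter_subset _ n)).trans
      ((hprob (hS n)).symm.trans_le (hcomp n))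
  have hsub : {ω | T ω < ⊤} ⊆ ⋂ n, {ω | S n ω < ⊤} :=
    fun ω hω => mem_iInter.2 fun n => (hST n ω).trans_lt hω
  have hae := ae_eq_of_subset_of_measure_ge hsub hle
    (hT.measurable measurableSet_Iio).nullMeasurableSet (measure_ne_top _ _)
  filter_upwards [hae.mem_iff] with ω hω hTω
  by_contra hcon
  have : ω ∈ ⋂ n, {ω | S n ω < ⊤} := mem_iInter.2 fun n =>
    lt_top_iff_ne_top.2 (not_exists.1 hcon n)
  exact (hω.2 this).ne hTω

/-! ### The joint Laplace transform of the time and the level of the maximum -/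

section Hit

variable {Ω : Type*} {m : MeasurableSpace Ω} {ℱ : Filtration ℝ≥0 m} {P : Measure Ω}
  {X : ℝ≥0 → Ω → ℝ} {θ Φ : ℝ → ℝ}

theorem discount_one_injective : Function.Injective (discount 1) := by
  intro s t hst
  unfold discount at hst
  split_ifs at hst with h1 h2 h2
  · rw [ENNReal.ofReal_eq_ofReal_iff (Real.exp_nonneg _) (Real.exp_nonneg _),
      Real.exp_eq_exp] at hst
    exact (ENNReal.toReal_eq_toReal_iff' h1.ne h2.ne).1 (by linarith)
  · exact absurd (ENNReal.ofReal_eq_zero.1 hst) (not_le.2 (Real.exp_pos _))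
  · exact absurd (ENNReal.ofReal_eq_zero.1 hst.symm) (not_le.2 (Real.exp_pos _))
  · rw [not_lt_top_iff.1 h1, not_lt_top_iff.1 h2]

theorem IsLaplaceExponent.ae_hitLevel_eq [IsProbabilityMeasure P] (h : IsLaplaceExponent P X θ Φ)
    (hX : IsSpectrallyNegative ℱ P X) {x : ℝ} (hx : 0 < x) :
    ∀ᵐ ω ∂P, hitLevel X x ω = firstPassage X x ω := by
  set xs : ℕ → ℝ := fun n => x - x * (1 / ((n : ℝ) + 1)) with hxs
  have hxs_lt : ∀ n, xs n < x := fun n =>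
    sub_lt_self _ (mul_pos hx Nat.one_div_pos_of_nat)
  have hxs_nonneg : ∀ n, 0 ≤ xs n := fun n => by
    have h1 : (1 : ℝ) / (n + 1) ≤ 1 := by
      rw [div_le_one (by positivity)]
      linarith [(n.cast_nonneg : (0 : ℝ) ≤ n)]
    simp only [hxs]
    nlinarith
  have hlim : Tendsto (fun n => ENNReal.ofReal (Real.exp (-(Φ 1 * xs n)))) atTop
      (𝓝 (ENNReal.ofReal (Real.exp (-(Φ 1 * x))))) := by
    have h1 : Tendsto xs atTop (𝓝 x) := by
      simpa [hxs] using (tendsto_one_div_add_atTop_nhds_zero_nat.const_mul x).const_sub x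
    exact (ENNReal.continuous_ofReal.tendsto _).comp
      ((Real.continuous_exp.tendsto _).comp (h1.const_mul _).neg)
  set G : Ω → ℝ≥0∞ := fun ω => ⨅ n, discount 1 (firstPassage X (xs n) ω) with hG
  have hGm : Measurable G := Measurable.iInf fun n =>
    (measurable_discount 1).comp (hX.isOptionalTime_firstPassage _).measurable
  have hle : ∀ ω, discount 1 (firstPassage X x ω) ≤ G ω := fun ω =>
    le_iInf fun n => discount_antitone zero_le_one (firstPassage_mono ω (hxs_lt n).le)
  have hlap : ∫⁻ ω, G ω ∂P ≤ ∫⁻ ω, discount 1 (firstPassage X x ω) ∂P := by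
    rw [h.lintegral_discount_firstPassage hX hx.le zero_le_one]
    refine ge_of_tendsto' hlim fun n => ?_
    rw [← h.lintegral_discount_firstPassage hX (hxs_nonneg n) zero_le_one]
    exact lintegral_mono fun ω => iInf_le _ n
  have hae := ae_eq_of_ae_le_of_lintegral_le (Eventually.of_forall hle)
    (by rw [h.lintegral_discount_firstPassage hX hx.le zero_le_one]; exact ENNReal.ofReal_ne_top)
    hGm.aemeasurable hlap
  filter_upwards [hae, hX.path] with ω hω hpath
  have hup : hitLevel X x ω ≤ firstPassage X x ω := by
    by_cases hT : firstPassage X x ω < ⊤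
    · refine sInf_le ⟨(firstPassage X x ω).toNNReal, ?_, ENNReal.coe_toNNReal hT.ne⟩
      exact hpath.apply_passage (hpath.zero.trans_le hx.le) hT
    · exact le_top.trans_eq (not_lt_top_iff.1 hT).symm
  have hlow : ∀ n, firstPassage X (xs n) ω ≤ hitLevel X x ω := by
    intro n
    refine le_sInf ?_
    rintro _ ⟨t, ht, rfl⟩
    exact hpath.passage_le zero_le ((hxs_lt n).trans_eq (Eq.symm ht))
  refine discount_one_injective (le_antisymm ?_ (discount_antitone zero_le_one hup))
  rw [hω]
  exact le_iInf fun n => discount_antitone zero_le_one (hlow n)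

end Hit

section Window

/-- The discounted time that the level `x` spends in a window of length `δ` below the overall
maximum of the path. -/
def window {Ω : Type*} (X : ℝ≥0 → Ω → ℝ) (a b δ : ℝ) (ω : Ω) : ℝ≥0∞ :=
  ∫⁻ x in Ioi (0 : ℝ), discount a (firstPassage X x ω) *
    (1 - discount 0 (firstPassage X (x + δ) ω)) * ENNReal.ofReal (Real.exp (-b * x))

variable {Ω : Type*} {X : ℝ≥0 → Ω → ℝ} {ω : Ω} {a b δ : ℝ}

theorem window_le (hf : IsRegularPath fun t => X t ω) (hb : BddAbove (range fun t => X t ω))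
    {C : ℝ≥0∞} (hC : ∀ x, 0 < x → (⨆ t, X t ω) - δ ≤ x →
      discount a (firstPassage X x ω) * ENNReal.ofReal (Real.exp (-b * x)) ≤ C) :
    window X a b δ ω ≤ C * ENNReal.ofReal δ := by
  set M := ⨆ t, X t ω
  have hpt : ∀ x ∈ Ioi (0 : ℝ), discount a (firstPassage X x ω) *
      (1 - discount 0 (firstPassage X (x + δ) ω)) * ENNReal.ofReal (Real.exp (-b * x)) ≤
        (Ico (M - δ) M).indicator (fun _ => C) x := by
    intro x hx
    by_cases hxM : x < M
    swap
    · have : firstPassage X x ω = ⊤ :=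
        not_lt_top_iff.1 fun h => hxM ((passage_zero_lt_top_iff hf hb).1 h)
      simp [this]
    by_cases hxδ : M - δ ≤ x
    · rw [indicator_of_mem (mem_Ico.2 ⟨hxδ, hxM⟩)]
      refine le_trans ?_ (hC x hx hxδ)
      gcongr
      exact mul_le_of_le_one_right zero_le tsub_le_self
    · have : firstPassage X (x + δ) ω < ⊤ :=
        (passage_zero_lt_top_iff hf hb).2 (by change _ < M; linarith)
      simp [discount_zero_eq_one this]
  refine (setLIntegral_mono' measurableSet_Ioi hpt).trans ((setLIntegral_le_lintegral _ _).trans ?_)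
  rw [lintegral_indicator_const measurableSet_Ico, Real.volume_Ico, sub_sub_cancel]

theorem le_window (hf : IsRegularPath fun t => X t ω) (hb : BddAbove (range fun t => X t ω))
    (ha : 0 ≤ a) (hb0 : 0 ≤ b) (hδ : δ ≤ ⨆ t, X t ω) {t : ℝ≥0} (ht : X t ω = ⨆ s, X s ω) :
    discount a t * ENNReal.ofReal (Real.exp (-b * ⨆ s, X s ω)) * ENNReal.ofReal δ ≤
      window X a b δ ω := by
  set M := ⨆ t, X t ω
  refine le_trans ?_ (lintegral_mono_set (s := Ioo (M - δ) M)
    fun x hx => (sub_nonneg.2 hδ).trans_lt hx.1)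
  have hvol : volume (Ioo (M - δ) M) = ENNReal.ofReal δ := by
    rw [Real.volume_Ioo, sub_sub_cancel]
  rw [← hvol, ← setLIntegral_const]
  refine setLIntegral_mono' measurableSet_Ioo fun x hx => ?_
  have htop : firstPassage X (x + δ) ω = ⊤ := not_lt_top_iff.1 fun h => by
    have : x + δ < M := (passage_zero_lt_top_iff hf hb).1 h
    linarith [hx.1]
  rw [htop, discount_top, tsub_zero, mul_one]
  gcongr ?_ * ENNReal.ofReal (Real.exp ?_)
  · exact discount_antitone ha (hf.passage_le zero_le (hx.2.trans_eq ht.symm))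
  · nlinarith [hx.2]

end Window

section JointLaplace

variable {Ω : Type*} {m : MeasurableSpace Ω} {ℱ : Filtration ℝ≥0 m} {P : Measure Ω}
  {X : ℝ≥0 → Ω → ℝ} {θ Φ : ℝ → ℝ}

theorem measurable_window_integrand (hX : ∀ t, Measurable (X t)) (a b δ : ℝ) :
    Measurable fun p : Ω × ℝ => discount a (firstPassage X p.2 p.1) *
      (1 - discount 0 (firstPassage X (p.2 + δ) p.1)) * ENNReal.ofReal (Real.exp (-b * p.2)) := by
  have hT := measurable_firstPassage_prod hX
  refine Measurable.mul (Measurable.mul ?_ (measurable_const.sub ?_)) (by fun_prop)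
  · exact (measurable_discount a).comp (hT.comp (measurable_snd.prodMk measurable_fst))
  · exact (measurable_discount 0).comp
      (hT.comp ((measurable_snd.add_const δ).prodMk measurable_fst))

variable [IsProbabilityMeasure P]

theorem IsLaplaceExponent.lintegral_window (h : IsLaplaceExponent P X θ Φ)
    (hX : IsSpectrallyNegative ℱ P X) {a b δ : ℝ} (ha : 0 ≤ a) (hb : 0 ≤ b) (hδ : 0 ≤ δ) :
    ∫⁻ ω, window X a b δ ω ∂P =
      ENNReal.ofReal ((1 - Real.exp (-(Φ 0 * δ))) / (Φ a + b)) := by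
  have hΦ := h.inverse_pos a ha
  have hexp : Real.exp (-(Φ 0 * δ)) ≤ 1 :=
    Real.exp_le_one_iff.2 (neg_nonpos.2 (mul_nonneg (h.inverse_pos 0 le_rfl).le hδ))
  have hx : ∀ x ∈ Ioi (0 : ℝ), ∫⁻ ω, discount a (firstPassage X x ω) *
      (1 - discount 0 (firstPassage X (x + δ) ω)) * ENNReal.ofReal (Real.exp (-b * x)) ∂P =
      ENNReal.ofReal (1 - Real.exp (-(Φ 0 * δ))) *
        ENNReal.ofReal (Real.exp (-(Φ a + b) * x)) := by
    intro x hx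
    have hx0 : 0 ≤ x := le_of_lt hx
    have hfin : ∀ ω, discount a (firstPassage X x ω) ≠ ⊤ := fun ω =>
      ne_top_of_le_ne_top ENNReal.one_ne_top (discount_le_one ha _)
    rw [lintegral_mul_const' _ _ ENNReal.ofReal_ne_top]
    simp_rw [ENNReal.mul_sub fun _ _ => hfin _, mul_one]
    rw [lintegral_sub, h.lintegral_discount_firstPassage hX hx0 ha,
      h.lintegral_discount_mul_discount hX hx0 hδ ha,
      ← ENNReal.ofReal_mul (Real.exp_nonneg _), ← ENNReal.ofReal_sub _ (by positivity),
      ← ENNReal.ofReal_mul (by nlinarith [Real.exp_pos (-(Φ a * x))]),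
      ← ENNReal.ofReal_mul (by linarith)]
    · congr 1
      rw [show -(Φ a + b) * x = -(Φ a * x) + -b * x by ring, Real.exp_add]
      ring
    · exact ((measurable_discount a).comp (hX.isOptionalTime_firstPassage _).measurable).mul
        ((measurable_discount 0).comp (hX.isOptionalTime_firstPassage _).measurable)
    · rw [h.lintegral_discount_mul_discount hX hx0 hδ ha]
      exact ENNReal.mul_ne_top ENNReal.ofReal_ne_top ENNReal.ofReal_ne_top
    · exact Eventually.of_forall fun ω =>
        mul_le_of_le_one_right zero_le (discount_le_one le_rfl _)
  unfold window
  rw [lintegral_lintegral_swap (measurable_window_integrand hX.measurable a b δ).aemeasurable,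
    setLIntegral_congr_fun measurableSet_Ioi hx, lintegral_const_mul' _ _ ENNReal.ofReal_ne_top,
    lintegral_exp_neg (by linarith), ← ENNReal.ofReal_mul (by linarith), mul_one_div]

theorem tendsto_mul_one_sub_exp (q : ℝ) :
    Tendsto (fun n : ℕ => ((n : ℝ) + 1) * (1 - Real.exp (-(q * (1 / ((n : ℝ) + 1)))))) atTop
      (𝓝 q) := by
  have hd : HasDerivAt (fun δ : ℝ => 1 - Real.exp (-(q * δ))) q 0 := by
    have h1 : HasDerivAt (fun δ : ℝ => -(q * δ)) (-(q * 1)) 0 :=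
      ((hasDerivAt_id (0 : ℝ)).const_mul q).fun_neg
    simpa using h1.exp.const_sub 1
  have h2 := hd.tendsto_slope_zero
  have h3 : Tendsto (fun n : ℕ => 1 / ((n : ℝ) + 1)) atTop (𝓝[≠] 0) :=
    tendsto_nhdsWithin_iff.2 ⟨tendsto_one_div_add_atTop_nhds_zero_nat,
      Eventually.of_forall fun n => (Nat.one_div_pos_of_nat (α := ℝ)).ne'⟩
  refine (h2.comp h3).congr fun n => ?_
  simp

theorem IsLaplaceExponent.tendsto_window (h : IsLaplaceExponent P X θ Φ)
    (hX : IsSpectrallyNegative ℱ P X) {a b : ℝ} (ha : 0 ≤ a) (hb : 0 ≤ b) {ρ : Ω → ℝ≥0}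
    (hρ : ∀ᵐ ω ∂P, X (ρ ω) ω = ⨆ t, X t ω) :
    ∀ᵐ ω ∂P, Tendsto (fun n : ℕ => window X a b (1 / ((n : ℝ) + 1)) ω *
      ENNReal.ofReal ((n : ℝ) + 1)) atTop
        (𝓝 (ENNReal.ofReal (Real.exp (-a * ρ ω - b * X (ρ ω) ω)))) := by
  have hback := ae_all_iff.2 fun r : ℚ => h.ae_back hX (Real.toNNReal r)
  filter_upwards [hρ, hX.path, h.ae_bddAbove hX, h.ae_exists_pos hX, hback]
    with ω hω hf hbdd ⟨t₀, ht₀⟩ hback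
  set M := ⨆ t, X t ω with hM
  have hM0 : 0 < M := ht₀.trans_le (le_ciSup hbdd t₀)
  have hcancel : ∀ n : ℕ, ENNReal.ofReal (1 / ((n : ℝ) + 1)) * ENNReal.ofReal ((n : ℝ) + 1) = 1 :=
    fun n => by
      rw [← ENNReal.ofReal_mul (Nat.one_div_pos_of_nat).le,
        one_div_mul_cancel (by positivity), ENNReal.ofReal_one]
  have hsmall : ∀ᶠ n : ℕ in atTop, 1 / ((n : ℝ) + 1) < M :=
    tendsto_one_div_add_atTop_nhds_zero_nat.eventually (gt_mem_nhds hM0)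
  have hval : ENNReal.ofReal (Real.exp (-a * ρ ω - b * X (ρ ω) ω)) =
      discount a (ρ ω) * ENNReal.ofReal (Real.exp (-b * M)) := by
    rw [discount, if_pos ENNReal.coe_lt_top, ENNReal.coe_toReal,
      ← ENNReal.ofReal_mul (Real.exp_nonneg _), ← Real.exp_add, hω]
    ring_nf
  have hT := hf.tendsto_passage hbdd hback hω
  have hTfin : ∀ n : ℕ, firstPassage X (M - 1 / ((n : ℝ) + 1)) ω < ⊤ := fun n =>
    (passage_zero_lt_top_iff hf hbdd).2 (sub_lt_self _ Nat.one_div_pos_of_nat)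
  rw [hval]
  refine tendsto_of_tendsto_of_tendsto_of_le_of_le' (tendsto_const_nhds)
    (h := fun n : ℕ => discount a (firstPassage X (M - 1 / ((n : ℝ) + 1)) ω) *
      ENNReal.ofReal (Real.exp (-b * (M - 1 / ((n : ℝ) + 1))))) ?_ ?_ ?_
  · refine ENNReal.Tendsto.mul ?_ (Or.inr ENNReal.ofReal_ne_top) ?_ (Or.inr ?_)
    · simp only [discount, if_pos (hTfin _), if_pos ENNReal.coe_lt_top]
      refine (ENNReal.continuous_ofReal.tendsto _).comp ((Real.continuous_exp.tendsto _).comp ?_)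
      exact ((ENNReal.tendsto_toReal ENNReal.coe_ne_top).comp hT).const_mul _
    · refine (ENNReal.continuous_ofReal.tendsto _).comp ((Real.continuous_exp.tendsto _).comp ?_)
      simpa using (tendsto_one_div_add_atTop_nhds_zero_nat.const_sub M).const_mul (-b)
    · exact ne_top_of_le_ne_top ENNReal.one_ne_top (discount_le_one ha _)
  · filter_upwards [hsmall] with n hn
    have := le_window (a := a) hf hbdd ha hb hn.le hω
    calc _ = discount a (ρ ω) * ENNReal.ofReal (Real.exp (-b * M)) *
          ENNReal.ofReal (1 / ((n : ℝ) + 1)) * ENNReal.ofReal ((n : ℝ) + 1) := by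
          rw [mul_assoc _ (ENNReal.ofReal (1 / ((n : ℝ) + 1))), hcancel, mul_one]
      _ ≤ _ := by gcongr
  · refine Eventually.of_forall fun n => ?_
    have := window_le (a := a) (b := b) (δ := 1 / ((n : ℝ) + 1)) hf hbdd
      (C := discount a (firstPassage X (M - 1 / ((n : ℝ) + 1)) ω) *
        ENNReal.ofReal (Real.exp (-b * (M - 1 / ((n : ℝ) + 1))))) fun x _ hx => by
          gcongr ?_ * ENNReal.ofReal (Real.exp ?_)
          · exact discount_antitone ha (firstPassage_mono ω hx)
          · nlinarith
    calc _ ≤ _ := mul_le_mul_left this _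
      _ = _ := by rw [mul_assoc _ (ENNReal.ofReal (1 / ((n : ℝ) + 1))), hcancel, mul_one]

/-- The joint Laplace transform of the time and the level of the overall maximum. -/
theorem IsLaplaceExponent.lintegral_exp_max (h : IsLaplaceExponent P X θ Φ)
    (hX : IsSpectrallyNegative ℱ P X) {a b : ℝ} (ha : 0 ≤ a) (hb : 0 ≤ b) {ρ : Ω → ℝ≥0}
    (hρ : ∀ᵐ ω ∂P, X (ρ ω) ω = ⨆ t, X t ω) :
    ∫⁻ ω, ENNReal.ofReal (Real.exp (-a * ρ ω - b * X (ρ ω) ω)) ∂P =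
      ENNReal.ofReal (Φ 0 / (Φ a + b)) := by
  have hΦ := h.inverse_pos a ha
  have h1 : Tendsto (fun n : ℕ => ∫⁻ ω, window X a b (1 / ((n : ℝ) + 1)) ω *
      ENNReal.ofReal ((n : ℝ) + 1) ∂P) atTop
      (𝓝 (∫⁻ ω, ENNReal.ofReal (Real.exp (-a * ρ ω - b * X (ρ ω) ω)) ∂P)) := by
    refine tendsto_lintegral_of_dominated_convergence' (fun _ => 1) (fun n => ?_) (fun n => ?_)
      (by simp) (h.tendsto_window hX ha hb hρ)
    · exact (Measurable.lintegral_prod_right'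
        (measurable_window_integrand hX.measurable a b _)).mul_const _ |>.aemeasurable
    · filter_upwards [hX.path, h.ae_bddAbove hX] with ω hf hbdd
      have := window_le (a := a) (b := b) (δ := 1 / ((n : ℝ) + 1)) hf hbdd (C := 1)
        fun x hx _ => mul_le_one' (discount_le_one ha _)
          (ENNReal.ofReal_le_one.2 (Real.exp_le_one_iff.2 (by nlinarith)))
      refine (mul_le_mul_left this _).trans ?_
      rw [one_mul, ← ENNReal.ofReal_mul (Nat.one_div_pos_of_nat).le,
        one_div_mul_cancel (by positivity), ENNReal.ofReal_one]
  refine tendsto_nhds_unique h1 ?_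
  have h2 : Tendsto (fun n : ℕ => ENNReal.ofReal
      (((n : ℝ) + 1) * (1 - Real.exp (-(Φ 0 * (1 / ((n : ℝ) + 1))))) / (Φ a + b))) atTop
      (𝓝 (ENNReal.ofReal (Φ 0 / (Φ a + b)))) :=
    (ENNReal.continuous_ofReal.tendsto _).comp ((tendsto_mul_one_sub_exp (Φ 0)).div_const _)
  refine h2.congr fun n => ?_
  have h3 : 0 ≤ (n : ℝ) + 1 := by positivity
  rw [lintegral_mul_const' _ _ ENNReal.ofReal_ne_top,
    h.lintegral_window hX ha hb (Nat.one_div_pos_of_nat).le, ← ENNReal.ofReal_mul' h3]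
  congr 1
  ring

end JointLaplace

/-! ### Uniqueness of Laplace transforms -/

section LaplaceUniqueness

open scoped BoundedContinuousFunction

/-- The bounded continuous function `(t, x) ↦ exp (-a t - b x)` on the quadrant. -/
def laplaceKernel (c : ℝ≥0 × ℝ≥0) : ℝ≥0 × ℝ≥0 →ᵇ ℝ :=
  BoundedContinuousFunction.ofNormedAddCommGroup
    (fun p => Real.exp (-(c.1 : ℝ) * p.1 - c.2 * p.2)) (by fun_prop) 1 fun p => by
      rw [Real.norm_of_nonneg (Real.exp_nonneg _), Real.exp_le_one_iff]
      have h1 : (0 : ℝ) ≤ c.1 * p.1 := by positivity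
      have h2 : (0 : ℝ) ≤ c.2 * p.2 := by positivity
      linarith

theorem laplaceKernel_apply (c p : ℝ≥0 × ℝ≥0) :
    laplaceKernel c p = Real.exp (-(c.1 : ℝ) * p.1 - c.2 * p.2) := rfl

/-- The functions `(t, x) ↦ exp (-a t - b x)` form a multiplicative monoid. -/
def laplaceMonoid : Submonoid (ℝ≥0 × ℝ≥0 →ᵇ ℝ) where
  carrier := range laplaceKernel
  one_mem' := ⟨0, by ext p; simp [laplaceKernel_apply]⟩
  mul_mem' := by
    rintro _ _ ⟨c, rfl⟩ ⟨d, rfl⟩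
    refine ⟨c + d, ?_⟩
    ext p
    simp only [laplaceKernel_apply, BoundedContinuousFunction.mul_apply, ← Real.exp_add,
      Prod.fst_add, Prod.snd_add, NNReal.coe_add]
    ring_nf

/-- Finite measures on the quadrant with the same Laplace transform are equal. -/
theorem ext_of_laplace {μ ν : Measure (ℝ≥0 × ℝ≥0)} [IsFiniteMeasure μ] [IsFiniteMeasure ν]
    (h : ∀ a b : ℝ≥0, ∫ p, Real.exp (-(a : ℝ) * p.1 - b * p.2) ∂μ =
      ∫ p, Real.exp (-(a : ℝ) * p.1 - b * p.2) ∂ν) : μ = ν := by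
  let A : StarSubalgebra ℝ (ℝ≥0 × ℝ≥0 →ᵇ ℝ) :=
    { Algebra.adjoin ℝ (laplaceMonoid : Set (ℝ≥0 × ℝ≥0 →ᵇ ℝ)) with
      star_mem' := fun {g} hg => by
        have : star g = g := by ext p; simp
        rwa [this] }
  refine ext_of_forall_mem_subalgebra_integral_eq_of_polish (𝕜 := ℝ) (A := A) ?_ ?_
  · intro p p' hpp
    have hmem : ∀ c, laplaceKernel c ∈ A := fun c => Algebra.subset_adjoin ⟨c, rfl⟩
    have hsep : ∃ c, laplaceKernel c p ≠ laplaceKernel c p' := by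
      by_contra! hall
      have h1 := hall (1, 0)
      have h2 := hall (0, 1)
      simp only [laplaceKernel_apply, Real.exp_eq_exp] at h1 h2
      refine hpp (Prod.ext (NNReal.eq ?_) (NNReal.eq ?_))
      · simpa using h1
      · simpa using h2
    obtain ⟨c, hc⟩ := hsep
    exact ⟨_, ⟨_, ⟨laplaceKernel c, hmem c, rfl⟩, rfl⟩, hc⟩
  · intro g hg
    have hspan : g ∈ Submodule.span ℝ (laplaceMonoid : Set (ℝ≥0 × ℝ≥0 →ᵇ ℝ)) := by
      have := Algebra.adjoin_eq_span (R := ℝ) (s := (laplaceMonoid : Set (ℝ≥0 × ℝ≥0 →ᵇ ℝ)))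
      rw [Submonoid.closure_eq] at this
      rw [← this]
      exact hg
    clear hg
    induction hspan using Submodule.span_induction with
    | mem g hg =>
      obtain ⟨c, rfl⟩ := hg
      exact h c.1 c.2
    | zero => simp
    | add f g _ _ hf hg =>
      simp only [BoundedContinuousFunction.coe_add, Pi.add_apply]
      rw [integral_add (f.integrable _) (g.integrable _),
        integral_add (f.integrable _) (g.integrable _), hf, hg]
    | smul r f _ hf =>
      simp only [BoundedContinuousFunction.coe_smul]
      rw [integral_smul, integral_smul, hf]

/-- A version of `ext_of_laplace` in terms of lower integrals. -/
theorem ext_of_lintegral_laplace {μ ν : Measure (ℝ≥0 × ℝ≥0)}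
    (hfin : ∫⁻ p : ℝ≥0 × ℝ≥0, ENNReal.ofReal (Real.exp (-0 * p.1 - 0 * p.2)) ∂μ ≠ ⊤)
    (h : ∀ a b : ℝ, 0 ≤ a → 0 ≤ b →
      ∫⁻ p, ENNReal.ofReal (Real.exp (-a * p.1 - b * p.2)) ∂μ =
        ∫⁻ p, ENNReal.ofReal (Real.exp (-a * p.1 - b * p.2)) ∂ν) : μ = ν := by
  have h0 := h 0 0 le_rfl le_rfl
  simp only [neg_zero, zero_mul, sub_self, Real.exp_zero, ENNReal.ofReal_one, lintegral_one]
    at h0 hfin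
  have : IsFiniteMeasure μ := ⟨hfin.lt_top⟩
  have : IsFiniteMeasure ν := ⟨h0 ▸ hfin.lt_top⟩
  refine ext_of_laplace fun a b => ?_
  rw [integral_eq_lintegral_of_nonneg_ae, integral_eq_lintegral_of_nonneg_ae,
    h a b a.coe_nonneg b.coe_nonneg]
  · exact Eventually.of_forall fun p => Real.exp_nonneg _
  · exact (laplaceKernel (a, b)).continuous.aestronglyMeasurable
  · exact Eventually.of_forall fun p => Real.exp_nonneg _
  · exact (laplaceKernel (a, b)).continuous.aestronglyMeasurable

end LaplaceUniqueness

theorem lintegral_eq_of_lintegral_laplace {α β : Type*} [MeasurableSpace α] [MeasurableSpace β]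
    {κ : Measure α} {η : Measure β} {d : α → ℝ≥0∞} {e : β → ℝ≥0∞} {φ : α → ℝ≥0 × ℝ≥0}
    {ψ : β → ℝ≥0 × ℝ≥0} (hd : Measurable d) (he : Measurable e) (hφ : Measurable φ)
    (hψ : Measurable ψ) {L : ℝ → ℝ → ℝ}
    (hκ : ∀ a b : ℝ, 0 ≤ a → 0 ≤ b →
      ∫⁻ x, d x * ENNReal.ofReal (Real.exp (-a * (φ x).1 - b * (φ x).2)) ∂κ =
        ENNReal.ofReal (L a b))
    (hη : ∀ a b : ℝ, 0 ≤ a → 0 ≤ b →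
      ∫⁻ x, e x * ENNReal.ofReal (Real.exp (-a * (ψ x).1 - b * (ψ x).2)) ∂η =
        ENNReal.ofReal (L a b))
    {g : ℝ≥0 × ℝ≥0 → ℝ≥0∞} (hg : Measurable g) :
    ∫⁻ x, d x * g (φ x) ∂κ = ∫⁻ x, e x * g (ψ x) ∂η := by
  have hκ' : ∀ {u : ℝ≥0 × ℝ≥0 → ℝ≥0∞}, Measurable u →
      ∫⁻ p, u p ∂((κ.withDensity d).map φ) = ∫⁻ x, d x * u (φ x) ∂κ := fun hu => by
    rw [lintegral_map hu hφ]
    exact lintegral_withDensity_eq_lintegral_mul _ hd (hu.comp hφ)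
  have hη' : ∀ {u : ℝ≥0 × ℝ≥0 → ℝ≥0∞}, Measurable u →
      ∫⁻ p, u p ∂((η.withDensity e).map ψ) = ∫⁻ x, e x * u (ψ x) ∂η := fun hu => by
    rw [lintegral_map hu hψ]
    exact lintegral_withDensity_eq_lintegral_mul _ he (hu.comp hψ)
  have hm : ∀ a b : ℝ, Measurable fun p : ℝ≥0 × ℝ≥0 =>
      ENNReal.ofReal (Real.exp (-a * p.1 - b * p.2)) := fun a b => by fun_prop
  have : (κ.withDensity d).map φ = (η.withDensity e).map ψ := by
    refine ext_of_lintegral_laplace ?_ fun a b ha hb => ?_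
    · rw [hκ' (hm 0 0), hκ 0 0 le_rfl le_rfl]
      exact ENNReal.ofReal_ne_top
    · rw [hκ' (hm a b), hη' (hm a b), hκ a b ha hb, hη a b ha hb]
  rw [← hκ' hg, this, hη' hg]

/-! ### The law of the maximum in terms of first passage times -/

section MaximumLaw

variable {Ω : Type*} {m : MeasurableSpace Ω} {ℱ : Filtration ℝ≥0 m} {P : Measure Ω}
  {X : ℝ≥0 → Ω → ℝ} {θ Φ : ℝ → ℝ} [IsProbabilityMeasure P]

/-- A weighted law on the quadrant with Laplace transform `Φ 0 / (Φ a + b)` is the joint law of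
the time and the level of the maximum. -/
theorem IsLaplaceExponent.lintegral_max_eq (h : IsLaplaceExponent P X θ Φ)
    (hX : IsSpectrallyNegative ℱ P X) {ρ : Ω → ℝ≥0} (hρm : Measurable ρ)
    (hρ : ∀ᵐ ω ∂P, X (ρ ω) ω = ⨆ t, X t ω) {β : Type*} [MeasurableSpace β] {η : Measure β}
    {e : β → ℝ≥0∞} (he : Measurable e) {ψ : β → ℝ≥0 × ℝ≥0} (hψ : Measurable ψ)
    (hη : ∀ a b : ℝ, 0 ≤ a → 0 ≤ b →
      ∫⁻ y, e y * ENNReal.ofReal (Real.exp (-a * (ψ y).1 - b * (ψ y).2)) ∂η =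
        ENNReal.ofReal (Φ 0 / (Φ a + b)))
    {g : ℝ × ℝ → ℝ≥0∞} (hg : Measurable g) :
    ∫⁻ ω, g (ρ ω, X (ρ ω) ω) ∂P = ∫⁻ y, e y * g ((ψ y).1, (ψ y).2) ∂η := by
  let φ : Ω → ℝ≥0 × ℝ≥0 := fun ω => (ρ ω, (jointVersion X (ρ ω, ω)).toNNReal)
  have hφ : Measurable φ := hρm.prodMk
    ((measurable_jointVersion hX.measurable).comp (hρm.prodMk measurable_id)).real_toNNReal
  have hφX : ∀ᵐ ω ∂P, ((φ ω).2 : ℝ) = X (ρ ω) ω := by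
    filter_upwards [hX.path, h.ae_bddAbove hX, hρ] with ω hf hb hω
    have h0 : 0 ≤ X (ρ ω) ω := by
      rw [hω, ← hf.zero]
      exact le_ciSup hb 0
    change ((jointVersion X (ρ ω, ω)).toNNReal : ℝ) = X (ρ ω) ω
    rw [hf.jointVersion_eq, Real.coe_toNNReal _ h0]
  have key := lintegral_eq_of_lintegral_laplace (κ := P) (η := η) (d := fun _ => 1)
    (g := fun p => g (p.1, p.2)) measurable_const he hφ hψ (fun a b ha hb => ?_) hη
    (by fun_prop)
  · rw [← key]
    refine lintegral_congr_ae ?_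
    filter_upwards [hφX] with ω hω
    rw [hω, one_mul]
  · rw [← h.lintegral_exp_max hX ha hb hρ]
    refine lintegral_congr_ae ?_
    filter_upwards [hφX] with ω hω
    rw [hω, one_mul]

theorem IsLaplaceExponent.lintegral_max_eq_firstPassage (h : IsLaplaceExponent P X θ Φ)
    (hX : IsSpectrallyNegative ℱ P X) {ρ : Ω → ℝ≥0} (hρm : Measurable ρ)
    (hρ : ∀ᵐ ω ∂P, X (ρ ω) ω = ⨆ t, X t ω) {g : ℝ × ℝ → ℝ≥0∞} (hg : Measurable g) :
    ∫⁻ ω, g (ρ ω, X (ρ ω) ω) ∂P = ∫⁻ x in Ioi (0 : ℝ), ENNReal.ofReal (Φ 0) *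
      ∫⁻ ω, (if firstPassage X x ω < ⊤ then g ((firstPassage X x ω).toNNReal, x) else 0) ∂P := by
  have hT := measurable_firstPassage_prod hX.measurable
  let e : ℝ × Ω → ℝ≥0∞ := fun y => ENNReal.ofReal (Φ 0) *
    if firstPassage X y.1 y.2 < ⊤ then 1 else 0
  have he : Measurable e := measurable_const.mul
    (Measurable.ite (hT measurableSet_Iio) measurable_const measurable_const)
  let ψ : ℝ × Ω → ℝ≥0 × ℝ≥0 := fun y => ((firstPassage X y.1 y.2).toNNReal, y.1.toNNReal)
  have hψ : Measurable ψ := hT.ennreal_toNNReal.prodMk measurable_fst.real_toNNReal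
  have hprod : ∀ {u : ℝ × ℝ → ℝ≥0∞}, Measurable u →
      ∫⁻ y, e y * u ((ψ y).1, (ψ y).2) ∂((volume.restrict (Ioi (0 : ℝ))).prod P) =
        ∫⁻ x in Ioi (0 : ℝ), ENNReal.ofReal (Φ 0) *
          ∫⁻ ω, (if firstPassage X x ω < ⊤ then u ((firstPassage X x ω).toNNReal, x) else 0)
            ∂P := by
    intro u hu
    have hm : Measurable fun y => e y * u ((ψ y).1, (ψ y).2) := he.mul (by fun_prop)
    rw [lintegral_prod _ hm.aemeasurable]
    refine setLIntegral_congr_fun measurableSet_Ioi fun x hx => ?_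
    change ∫⁻ ω, e (x, ω) * u ((ψ (x, ω)).1, (ψ (x, ω)).2) ∂P = _
    rw [← lintegral_const_mul' _ _ ENNReal.ofReal_ne_top]
    refine lintegral_congr fun ω => ?_
    change ENNReal.ofReal (Φ 0) * (if firstPassage X x ω < ⊤ then 1 else 0) *
      u (((firstPassage X x ω).toNNReal : ℝ), (x.toNNReal : ℝ)) = _
    rw [Real.coe_toNNReal _ (le_of_lt hx), mul_assoc, ite_mul, one_mul, zero_mul]
  rw [h.lintegral_max_eq hX hρm hρ he hψ (fun a b ha hb => ?_) hg, hprod hg]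
  have hΦ := h.inverse_pos a ha
  rw [hprod (u := fun p => ENNReal.ofReal (Real.exp (-a * p.1 - b * p.2))) (by fun_prop),
    lintegral_const_mul' _ _ ENNReal.ofReal_ne_top, div_eq_mul_one_div,
    ENNReal.ofReal_mul (h.inverse_pos 0 le_rfl).le, ← lintegral_exp_neg (by positivity)]
  congr 1
  refine setLIntegral_congr_fun measurableSet_Ioi fun x hx => ?_
  have hdisc : ∀ ω, (if firstPassage X x ω < ⊤ then ENNReal.ofReal (Real.exp
      (-a * ((firstPassage X x ω).toNNReal : ℝ) - b * x)) else 0) =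
      ENNReal.ofReal (Real.exp (-b * x)) * discount a (firstPassage X x ω) := fun ω => by
    rw [discount, mul_ite, mul_zero, ← ENNReal.ofReal_mul (Real.exp_nonneg _), ← Real.exp_add,
      ENNReal.coe_toNNReal_eq_toReal]
    ring_nf
  simp only [hdisc]
  rw [lintegral_const_mul' _ _ ENNReal.ofReal_ne_top,
    h.lintegral_discount_firstPassage hX (le_of_lt hx) ha,
    ← ENNReal.ofReal_mul (Real.exp_nonneg _), ← Real.exp_add]
  ring_nf

end MaximumLaw

/-! ### The resolvent on the positive half-line -/

section Resolvent

variable {Ω : Type*} {m : MeasurableSpace Ω} {ℱ : Filtration ℝ≥0 m} {P : Measure Ω}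
  {X : ℝ≥0 → Ω → ℝ} {θ Φ : ℝ → ℝ}

/-- The resolvent kernel of the process started at zero, as a measure. -/
def resolventMeasure (P : Measure Ω) (X : ℝ≥0 → Ω → ℝ) (c : ℝ) : Measure ℝ :=
  (((volume.restrict (Ioi (0 : ℝ))).withDensity
    fun t => ENNReal.ofReal (Real.exp (-c * t))).prod P).map
      fun y => jointVersion X (y.1.toNNReal, y.2)

theorem measurable_jointVersion_toNNReal (hX : ∀ t, Measurable (X t)) :
    Measurable fun y : ℝ × Ω => jointVersion X (y.1.toNNReal, y.2) :=
  (measurable_jointVersion hX).comp (measurable_fst.real_toNNReal.prodMk measurable_snd)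

theorem IsSpectrallyNegative.lintegral_resolventMeasure [SFinite P]
    (hX : IsSpectrallyNegative ℱ P X) (c : ℝ) {u : ℝ → ℝ≥0∞} (hu : Measurable u) :
    ∫⁻ x, u x ∂(resolventMeasure P X c) = resolvent P X c u := by
  have hJ := measurable_jointVersion_toNNReal hX.measurable
  have huJ : Measurable fun y : ℝ × Ω => u (jointVersion X (y.1.toNNReal, y.2)) := hu.comp hJ
  rw [resolventMeasure, lintegral_map hu hJ, lintegral_prod _ huJ.aemeasurable,
    lintegral_withDensity_eq_lintegral_mul _ (by fun_prop)
      (measurable_resolvent_integrand hX hu), resolvent]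
  refine lintegral_congr fun t => ?_
  simp only [Pi.mul_apply]
  rw [hX.lintegral_jointVersion u]

theorem IsSpectrallyNegative.resolvent_eq_lintegral_path [SFinite P]
    (hX : IsSpectrallyNegative ℱ P X) (c : ℝ) {u : ℝ → ℝ≥0∞} (hu : Measurable u) :
    resolvent P X c u = ∫⁻ ω, (∫⁻ r in Ioi (0 : ℝ), ENNReal.ofReal (Real.exp (-c * r)) *
      u (jointVersion X (r.toNNReal, ω))) ∂P := by
  have hJ : Measurable fun y : Ω × ℝ => jointVersion X (y.2.toNNReal, y.1) :=
    (measurable_jointVersion hX.measurable).comp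
      (measurable_snd.real_toNNReal.prodMk measurable_fst)
  have hm : Measurable fun y : Ω × ℝ => ENNReal.ofReal (Real.exp (-c * y.2)) *
      u (jointVersion X (y.2.toNNReal, y.1)) :=
    Measurable.mul (by fun_prop) (hu.comp hJ)
  rw [lintegral_lintegral_swap hm.aemeasurable, resolvent]
  refine lintegral_congr fun r => ?_
  rw [lintegral_const_mul' _ _ ENNReal.ofReal_ne_top, hX.lintegral_jointVersion]

variable [IsProbabilityMeasure P]

theorem IsSpectrallyNegative.resolventMeasure_univ (hX : IsSpectrallyNegative ℱ P X) {c : ℝ}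
    (hc : 0 < c) : resolventMeasure P X c univ = ENNReal.ofReal (1 / c) := by
  rw [← lintegral_one, hX.lintegral_resolventMeasure c measurable_const, resolvent,
    ← lintegral_exp_neg hc]
  simp

theorem IsLaplaceExponent.resolventMeasure_Ioi (h : IsLaplaceExponent P X θ Φ)
    (hX : IsSpectrallyNegative ℱ P X) {c x : ℝ} (hc : 0 ≤ c) (hx : 0 ≤ x) :
    resolventMeasure P X c (Ioi x) =
      ENNReal.ofReal (Real.exp (-(Φ c * x))) * resolventMeasure P X c (Ioi 0) := by
  have hind : ∀ y, Measurable ((Ioi y).indicator (1 : ℝ → ℝ≥0∞)) := fun y =>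
    measurable_one.indicator measurableSet_Ioi
  have hU : ∀ y, resolventMeasure P X c (Ioi y) = resolvent P X c ((Ioi y).indicator 1) :=
    fun y => by
      rw [← hX.lintegral_resolventMeasure c (hind y), lintegral_indicator_one measurableSet_Ioi]
  have hS := hX.isOptionalTime_firstPassage x
  have key := hX.lintegral_after hS hS.isKnownAt_one (fun _ => le_rfl) hc (hind 0)
  simp only [one_mul] at key
  rw [h.lintegral_discount_firstPassage hX hx hc] at key
  rw [hU, hU, ← key]
  rw [hX.resolvent_eq_lintegral_path c (hind x)]
  refine lintegral_congr_ae ?_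
  filter_upwards [hX.path] with ω hf
  have hle : ∀ r : ℝ, (r.toNNReal : ℝ≥0∞) < firstPassage X x ω → X r.toNNReal ω ≤ x :=
    fun r hr => hf.le_of_lt_passage zero_le hr
  simp only [hf.jointVersion_eq]
  split_ifs with hT
  · have hXT : X (firstPassage X x ω).toNNReal ω = x :=
      hf.apply_passage (by rw [hf.zero]; exact hx) hT
    have hset : Ioi (firstPassage X x ω).toReal ⊆ Ioi (0 : ℝ) :=
      Ioi_subset_Ioi ENNReal.toReal_nonneg
    rw [hXT, ← lintegral_indicator measurableSet_Ioi, ← lintegral_indicator measurableSet_Ioi]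
    refine lintegral_congr fun r => ?_
    by_cases hr : (firstPassage X x ω).toReal < r
    · rw [indicator_of_mem (hset hr), indicator_of_mem (show r ∈ Ioi _ from hr)]
      simp only [indicator, mem_Ioi, sub_pos, Pi.one_apply]
    · rw [indicator_of_notMem (s := Ioi (firstPassage X x ω).toReal) (by exact hr)]
      by_cases hr0 : 0 < r
      · rw [indicator_of_mem (show r ∈ Ioi _ from hr0)]
        have : ¬ x < X r.toNNReal ω := by
          rw [not_lt]
          rcases (not_lt.1 hr).lt_or_eq with h1 | h1
          · refine hle r ?_
            rw [← ENNReal.ofReal_toReal hT.ne]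
            exact (ENNReal.ofReal_lt_ofReal_iff_of_nonneg hr0.le).2 h1
          · rw [h1, ENNReal.toNNReal_toReal_eq]
            exact hXT.le
        rw [indicator_of_notMem (by exact this), mul_zero]
      · rw [indicator_of_notMem (by exact hr0)]
  · have : ∀ r : ℝ, X r.toNNReal ω ∉ Ioi x := fun r => by
      rw [mem_Ioi, not_lt]
      exact hle r (by rw [not_lt_top_iff.1 hT]; exact ENNReal.coe_lt_top)
    simp only [indicator_of_notMem (this _), mul_zero, lintegral_zero]

theorem lintegral_Ioi_exp_neg {r : ℝ} (hr : 0 < r) (x : ℝ) :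
    ∫⁻ y in Ioi x, ENNReal.ofReal (Real.exp (-r * y)) =
      ENNReal.ofReal (Real.exp (-r * x) / r) := by
  rw [← ofReal_integral_eq_lintegral_ofReal (integrableOn_exp_mul_Ioi (by linarith) x)
    (Eventually.of_forall fun u => Real.exp_nonneg _), integral_exp_mul_Ioi (by linarith),
    neg_div_neg_eq]

/-- On the positive half-line the resolvent is a multiple of an exponential law. -/
theorem IsLaplaceExponent.restrict_resolventMeasure (h : IsLaplaceExponent P X θ Φ)
    (hX : IsSpectrallyNegative ℱ P X) {c : ℝ} (hc : 0 < c) :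
    (resolventMeasure P X c).restrict (Ioi 0) =
      (volume.restrict (Ioi (0 : ℝ))).withDensity fun x =>
        ENNReal.ofReal ((resolventMeasure P X c (Ioi 0)).toReal * Φ c) *
          ENNReal.ofReal (Real.exp (-Φ c * x)) := by
  have hΦ := h.inverse_pos c hc.le
  have hfin : IsFiniteMeasure (resolventMeasure P X c) :=
    ⟨by rw [hX.resolventMeasure_univ hc]; exact ENNReal.ofReal_lt_top⟩
  set A := resolventMeasure P X c (Ioi 0) with hA
  have hAtop : A ≠ ⊤ := measure_ne_top _ _
  have htail : ∀ x : ℝ, (resolventMeasure P X c).restrict (Ioi 0) (Ioi x) =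
      (volume.restrict (Ioi (0 : ℝ))).withDensity (fun x =>
        ENNReal.ofReal (A.toReal * Φ c) * ENNReal.ofReal (Real.exp (-Φ c * x))) (Ioi x) := by
    intro x
    rw [withDensity_apply _ measurableSet_Ioi, Measure.restrict_restrict measurableSet_Ioi,
      Measure.restrict_apply measurableSet_Ioi, Ioi_inter_Ioi,
      lintegral_const_mul' _ _ ENNReal.ofReal_ne_top, lintegral_Ioi_exp_neg hΦ,
      h.resolventMeasure_Ioi hX hc.le le_sup_right, ← hA, ← ENNReal.ofReal_mul (by positivity)]
    conv_lhs => rw [← ENNReal.ofReal_toReal hAtop, ← ENNReal.ofReal_mul (Real.exp_nonneg _)]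
    congr 1
    rw [neg_mul]
    field_simp
  refine ext_of_generate_finite (range Ioi)
    (by rw [BorelSpace.measurable_eq (α := ℝ), borel_eq_generateFrom_Ioi]) isPiSystem_Ioi ?_ ?_
  · rintro _ ⟨x, rfl⟩
    exact htail x
  · have h0 := htail 0
    rw [withDensity_apply _ measurableSet_Ioi, Measure.restrict_restrict measurableSet_Ioi,
      Measure.restrict_apply measurableSet_Ioi, inter_self] at h0
    rw [withDensity_apply _ MeasurableSet.univ, Measure.restrict_univ,
      Measure.restrict_apply_univ, h0]

end Resolvent

/-! ### The law of the maximum in terms of the one-dimensional marginals -/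

section Marginals

variable {Ω : Type*} {m : MeasurableSpace Ω} {ℱ : Filtration ℝ≥0 m} {P : Measure Ω}
  {X : ℝ≥0 → Ω → ℝ} {θ Φ : ℝ → ℝ} [IsProbabilityMeasure P]

theorem IsLaplaceExponent.setLIntegral_resolventMeasure (h : IsLaplaceExponent P X θ Φ)
    (hX : IsSpectrallyNegative ℱ P X) {c : ℝ} (hc : 0 < c) {u : ℝ → ℝ≥0∞} (hu : Measurable u) :
    ∫⁻ x in Ioi 0, u x ∂(resolventMeasure P X c) =
      ENNReal.ofReal ((resolventMeasure P X c (Ioi 0)).toReal * Φ c) *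
        ∫⁻ x in Ioi (0 : ℝ), ENNReal.ofReal (Real.exp (-Φ c * x)) * u x := by
  rw [h.restrict_resolventMeasure hX hc,
    lintegral_withDensity_eq_lintegral_mul _ (by fun_prop) hu,
    ← lintegral_const_mul' _ _ ENNReal.ofReal_ne_top]
  simp only [Pi.mul_apply, mul_assoc]

theorem IsLaplaceExponent.abs_sub_le (h : IsLaplaceExponent P X θ Φ)
    (hX : IsSpectrallyNegative ℱ P X) {c z : ℝ} (hc : 0 < c) (hz : 0 ≤ z) (hzc : z < Φ c) :
    |(Φ c - z) / (c - θ z) - (resolventMeasure P X c (Ioi 0)).toReal * Φ c| ≤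
      (Φ c - z) * (1 / c) := by
  have hΦ := h.inverse_pos c hc.le
  have hθ := h.lt_of_lt_inverse hc hz hzc
  set α := (resolventMeasure P X c (Ioi 0)).toReal * Φ c with hα
  have hα0 : 0 ≤ α := mul_nonneg ENNReal.toReal_nonneg hΦ.le
  have hm := measurable_ofReal_exp_mul z
  have h1 := h.resolvent_exp hz hθ
  rw [← hX.lintegral_resolventMeasure c hm,
    ← lintegral_add_compl _ (measurableSet_Ioi (a := (0 : ℝ))),
    h.setLIntegral_resolventMeasure hX hc hm, ← hα] at h1
  have h2 : ∫⁻ x in Ioi (0 : ℝ), ENNReal.ofReal (Real.exp (-Φ c * x)) *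
      ENNReal.ofReal (Real.exp (z * x)) = ENNReal.ofReal (1 / (Φ c - z)) := by
    rw [← lintegral_exp_neg (sub_pos.2 hzc)]
    refine lintegral_congr fun x => ?_
    rw [← ENNReal.ofReal_mul (Real.exp_nonneg _), ← Real.exp_add]
    ring_nf
  set β := ∫⁻ x in (Ioi 0)ᶜ, ENNReal.ofReal (Real.exp (z * x)) ∂(resolventMeasure P X c)
    with hβ
  have hβ1 : β ≤ ENNReal.ofReal (1 / c) := by
    rw [← hX.resolventMeasure_univ hc, ← lintegral_one]
    refine le_trans (setLIntegral_mono' measurableSet_Ioi.compl fun x hx => ?_)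
      (setLIntegral_le_lintegral _ _)
    rw [← ENNReal.ofReal_one]
    refine ENNReal.ofReal_le_ofReal (Real.exp_le_one_iff.2 ?_)
    exact mul_nonpos_of_nonneg_of_nonpos hz (not_lt.1 hx)
  rw [h2, ← ENNReal.ofReal_mul hα0, ← ENNReal.ofReal_toReal
    (hβ1.trans_lt ENNReal.ofReal_lt_top).ne, ← ENNReal.ofReal_add
    (mul_nonneg hα0 (one_div_nonneg.2 (sub_pos.2 hzc).le)) ENNReal.toReal_nonneg,
    ENNReal.ofReal_eq_ofReal_iff (add_nonneg (mul_nonneg hα0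
      (one_div_nonneg.2 (sub_pos.2 hzc).le)) ENNReal.toReal_nonneg)
      (one_div_nonneg.2 (sub_pos.2 hθ).le)] at h1
  have hβ2 : β.toReal ≤ 1 / c := ENNReal.toReal_le_of_le_ofReal (by positivity) hβ1
  have hpos := sub_pos.2 hzc
  have h3 : (Φ c - z) / (c - θ z) - α = (Φ c - z) * β.toReal := by
    rw [div_eq_mul_one_div, ← h1]
    field_simp
    ring
  rw [h3, abs_of_nonneg (mul_nonneg hpos.le ENNReal.toReal_nonneg)]
  exact mul_le_mul_of_nonneg_left hβ2 hpos.le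

theorem IsLaplaceExponent.resolventMeasure_mul_deriv (h : IsLaplaceExponent P X θ Φ)
    (hX : IsSpectrallyNegative ℱ P X) {c : ℝ} (hc : 0 < c) :
    (resolventMeasure P X c (Ioi 0)).toReal * Φ c * deriv θ (Φ c) = 1 := by
  have hΦ := h.inverse_pos c hc.le
  have hev : ∀ᶠ z in 𝓝[<] Φ c, 0 ≤ z ∧ z < Φ c := by
    filter_upwards [Ioo_mem_nhdsLT hΦ] with z hz using ⟨hz.1.le, hz.2⟩
  have h1 : Tendsto (fun z => (Φ c - z) / (c - θ z)) (𝓝[<] Φ c)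
      (𝓝 ((resolventMeasure P X c (Ioi 0)).toReal * Φ c)) := by
    rw [tendsto_iff_dist_tendsto_zero]
    have h0 : Tendsto (fun z => (Φ c - z) * (1 / c)) (𝓝[<] Φ c) (𝓝 0) := by
      have : Continuous fun z => (Φ c - z) * (1 / c) := by fun_prop
      simpa using (this.tendsto (Φ c)).mono_left nhdsWithin_le_nhds
    refine squeeze_zero' (Eventually.of_forall fun z => dist_nonneg) ?_ h0
    filter_upwards [hev] with z hz
    rw [Real.dist_eq]
    exact h.abs_sub_le hX hc hz.1 hz.2
  have h2 : Tendsto (slope θ (Φ c)) (𝓝[<] Φ c) (𝓝 (deriv θ (Φ c))) :=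
    (h.differentiableAt hΦ).hasDerivAt.tendsto_slope.mono_left
      (nhdsWithin_mono _ fun z hz => ne_of_lt hz)
  refine tendsto_nhds_unique (h1.mul h2) (tendsto_const_nhds.congr' ?_)
  filter_upwards [hev] with z hz
  have hθ := sub_pos.2 (h.lt_of_lt_inverse hc hz.1 hz.2)
  have hz' := sub_pos.2 hz.2
  rw [slope_def_field, h.apply_inverse c hc.le, ← neg_sub (Φ c) z, ← neg_sub c (θ z),
    neg_div_neg_eq]
  field_simp

theorem lintegral_Ioi_mul_exp_neg {r : ℝ} (hr : 0 < r) :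
    ∫⁻ x in Ioi (0 : ℝ), ENNReal.ofReal (x * Real.exp (-r * x)) =
      ENNReal.ofReal (1 / r ^ 2) := by
  have h1 : ∫ x in Ioi (0 : ℝ), x * Real.exp (-r * x) = 1 / r ^ 2 := by
    have := Real.integral_rpow_mul_exp_neg_mul_Ioi (a := 2) (r := r) two_pos hr
    norm_num [Real.Gamma_two] at this
    simpa [neg_mul, one_div] using this
  rw [← h1, ofReal_integral_eq_lintegral_ofReal]
  · by_contra hn
    rw [integral_undef hn] at h1
    exact (by positivity : (0 : ℝ) < 1 / r ^ 2).ne h1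
  · filter_upwards [ae_restrict_mem measurableSet_Ioi] with x hx
    exact mul_nonneg (le_of_lt hx) (Real.exp_nonneg _)

theorem IsLaplaceExponent.resolvent_mul_exp (h : IsLaplaceExponent P X θ Φ)
    (hX : IsSpectrallyNegative ℱ P X) {b c : ℝ} (hb : 0 ≤ b) (hc : 0 < c) :
    resolvent P X c (fun x => ENNReal.ofReal (x * Real.exp (-b * x))) =
      ENNReal.ofReal (1 / (deriv θ (Φ c) * (Φ c + b) ^ 2)) := by
  have hΦ := h.inverse_pos c hc.le
  have hm : Measurable fun x : ℝ => ENNReal.ofReal (x * Real.exp (-b * x)) := by fun_prop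
  have hneg : ∫⁻ x in (Ioi 0)ᶜ, ENNReal.ofReal (x * Real.exp (-b * x))
      ∂(resolventMeasure P X c) = 0 := by
    refine setLIntegral_eq_zero measurableSet_Ioi.compl fun x hx => ?_
    exact ENNReal.ofReal_of_nonpos (mul_nonpos_of_nonpos_of_nonneg (not_lt.1 hx)
      (Real.exp_nonneg _))
  rw [← hX.lintegral_resolventMeasure c hm,
    ← lintegral_add_compl _ (measurableSet_Ioi (a := (0 : ℝ))),
    hneg, add_zero, h.setLIntegral_resolventMeasure hX hc hm,
    eq_one_div_of_mul_eq_one_left (h.resolventMeasure_mul_deriv hX hc),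
    ← one_div_mul_one_div, ENNReal.ofReal_mul' (by positivity),
    ← lintegral_Ioi_mul_exp_neg (by positivity)]
  congr 1
  refine lintegral_congr fun x => ?_
  rw [← ENNReal.ofReal_mul (Real.exp_nonneg _), mul_left_comm, ← Real.exp_add]
  ring_nf

theorem lintegral_Ioi_one_div_sq {p b : ℝ} (hp : 0 < p + b) :
    ∫⁻ z in Ioi p, ENNReal.ofReal (1 / (z + b) ^ 2) = ENNReal.ofReal (1 / (p + b)) := by
  have hd : ∀ z ∈ Ici p, HasDerivAt (fun z => -(1 / (z + b))) (1 / (z + b) ^ 2) z := by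
    intro z hz
    have hz0 : z + b ≠ 0 := by
      have : p ≤ z := hz
      linarith
    have := (((hasDerivAt_id z).add_const b).fun_inv hz0).fun_neg
    simpa [one_div, neg_div] using this
  have ht : Tendsto (fun z : ℝ => -(1 / (z + b))) atTop (𝓝 0) := by
    have := (tendsto_inv_atTop_zero.comp (tendsto_atTop_add_const_right _ b tendsto_id)).neg
    simpa [one_div] using this
  have hnn : ∀ z ∈ Ioi p, 0 ≤ 1 / (z + b) ^ 2 := fun z _ => by positivity
  rw [← ofReal_integral_eq_lintegral_ofReal (integrableOn_Ioi_deriv_of_nonneg' hd hnn ht)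
    (Eventually.of_forall fun z => by positivity),
    integral_Ioi_of_hasDerivAt_of_nonneg' hd hnn ht]
  simp

end Marginals

section Kendall

variable {Ω : Type*} {m : MeasurableSpace Ω} {ℱ : Filtration ℝ≥0 m} {P : Measure Ω}
  {X : ℝ≥0 → Ω → ℝ} {θ Φ : ℝ → ℝ} [IsProbabilityMeasure P]

theorem IsLaplaceExponent.image_Ioi (h : IsLaplaceExponent P X θ Φ) {a : ℝ} (ha : 0 ≤ a) :
    θ '' Ioi (Φ a) = Ioi a := by
  ext s
  constructor
  · rintro ⟨z, hz, rfl⟩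
    rw [mem_Ioi, ← h.apply_inverse a ha]
    exact h.strictMonoOn (h.root_le_inverse ha)
      ((h.root_le_inverse ha).trans (le_of_lt hz)) hz
  · intro hs
    have hs0 : 0 ≤ s := ha.trans (le_of_lt hs)
    exact ⟨Φ s, h.inverse_mono ha hs0 hs, h.apply_inverse s hs0⟩

theorem IsLaplaceExponent.lintegral_resolvent_mul_exp (h : IsLaplaceExponent P X θ Φ)
    (hX : IsSpectrallyNegative ℱ P X) {a b : ℝ} (ha : 0 ≤ a) (hb : 0 ≤ b) :
    ∫⁻ s in Ioi a, resolvent P X s (fun x => ENNReal.ofReal (x * Real.exp (-b * x))) =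
      ENNReal.ofReal (1 / (Φ a + b)) := by
  have hΦ := h.inverse_pos a ha
  rw [setLIntegral_congr_fun measurableSet_Ioi
    fun s hs => h.resolvent_mul_exp hX hb (ha.trans_lt hs), ← h.image_Ioi ha,
    lintegral_image_eq_lintegral_abs_deriv_mul measurableSet_Ioi (fun z hz =>
      (h.differentiableAt (hΦ.trans hz)).hasDerivAt.hasDerivWithinAt)
      (h.strictMonoOn.injOn.mono fun z hz => (h.root_le_inverse ha).trans (le_of_lt hz)),
    ← lintegral_Ioi_one_div_sq (by positivity)]
  refine setLIntegral_congr_fun measurableSet_Ioi fun z hz => ?_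
  have hz' : Φ a < z := hz
  have hroot : Φ 0 < z := (h.root_le_inverse ha).trans_lt hz'
  have hinv := h.inverse_apply hroot.le
  have hderiv := h.resolventMeasure_mul_deriv hX (h.pos_of_root_lt hroot)
  rw [hinv] at hderiv
  have hpos : 0 < deriv θ z := by
    refine pos_of_mul_pos_right (hderiv ▸ one_pos) ?_
    exact mul_nonneg ENNReal.toReal_nonneg (hΦ.trans hz').le
  have hzb : 0 < z + b := by linarith
  simp only [hinv]
  rw [← ENNReal.ofReal_mul (abs_nonneg _), abs_of_pos hpos]
  congr 1
  field_simp

theorem IsLaplaceExponent.lintegral_marginal_exp (h : IsLaplaceExponent P X θ Φ)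
    (hX : IsSpectrallyNegative ℱ P X) {a b : ℝ} (ha : 0 ≤ a) (hb : 0 ≤ b) :
    ∫⁻ t in Ioi (0 : ℝ), ENNReal.ofReal (Real.exp (-a * t) / t) *
      ∫⁻ ω, ENNReal.ofReal (X t.toNNReal ω * Real.exp (-b * X t.toNNReal ω)) ∂P =
        ENNReal.ofReal (1 / (Φ a + b)) := by
  let u : ℝ → ℝ≥0∞ := fun x => ENNReal.ofReal (x * Real.exp (-b * x))
  have hu : Measurable u := by fun_prop
  have hU := measurable_resolvent_integrand hX hu
  simp only [hX.lintegral_jointVersion u] at hU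
  have hm : Measurable fun y : ℝ × ℝ => ENNReal.ofReal (Real.exp (-y.1 * y.2)) *
      ∫⁻ ω, u (X y.2.toNNReal ω) ∂P :=
    Measurable.mul (by fun_prop) (hU.comp measurable_snd)
  rw [← h.lintegral_resolvent_mul_exp hX ha hb]
  simp only [resolvent]
  rw [lintegral_lintegral_swap hm.aemeasurable]
  refine setLIntegral_congr_fun measurableSet_Ioi fun t ht => ?_
  have hlap : ∫⁻ s in Ioi a, ENNReal.ofReal (Real.exp (-s * t)) =
      ENNReal.ofReal (Real.exp (-a * t) / t) := by
    have := lintegral_Ioi_exp_neg (show 0 < t from ht) a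
    simpa only [neg_mul, mul_comm t] using this
  rw [lintegral_mul_const _ (by fun_prop), hlap]

theorem IsLaplaceExponent.lintegral_max_eq_marginal (h : IsLaplaceExponent P X θ Φ)
    (hX : IsSpectrallyNegative ℱ P X) {ρ : Ω → ℝ≥0} (hρm : Measurable ρ)
    (hρ : ∀ᵐ ω ∂P, X (ρ ω) ω = ⨆ t, X t ω) {g : ℝ × ℝ → ℝ≥0∞} (hg : Measurable g) :
    ∫⁻ ω, g (ρ ω, X (ρ ω) ω) ∂P = ∫⁻ t in Ioi (0 : ℝ),
      ∫⁻ ω, g (t, X t.toNNReal ω) * ENNReal.ofReal (Φ 0 * X t.toNNReal ω / t) ∂P := by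
  have hJ := measurable_jointVersion_toNNReal hX.measurable
  have hq := h.inverse_pos 0 le_rfl
  let e : ℝ × Ω → ℝ≥0∞ := fun y =>
    ENNReal.ofReal (Φ 0 * jointVersion X (y.1.toNNReal, y.2) / y.1)
  have he : Measurable e := ((hJ.const_mul _).div measurable_fst).ennreal_ofReal
  let ψ : ℝ × Ω → ℝ≥0 × ℝ≥0 := fun y =>
    (y.1.toNNReal, (jointVersion X (y.1.toNNReal, y.2)).toNNReal)
  have hψ : Measurable ψ := measurable_fst.real_toNNReal.prodMk hJ.real_toNNReal
  have hprod : ∀ {u : ℝ × ℝ → ℝ≥0∞}, Measurable u →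
      ∫⁻ y, e y * u ((ψ y).1, (ψ y).2) ∂((volume.restrict (Ioi (0 : ℝ))).prod P) =
        ∫⁻ t in Ioi (0 : ℝ), ∫⁻ ω, u (t, X t.toNNReal ω) *
          ENNReal.ofReal (Φ 0 * X t.toNNReal ω / t) ∂P := by
    intro u hu
    have hm : Measurable fun y => e y * u ((ψ y).1, (ψ y).2) := he.mul (by fun_prop)
    rw [lintegral_prod _ hm.aemeasurable]
    refine setLIntegral_congr_fun measurableSet_Ioi fun t ht => ?_
    have ht0 : 0 < t := ht
    rw [← hX.lintegral_jointVersion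
      fun x => u (t, x) * ENNReal.ofReal (Φ 0 * x / t)]
    refine lintegral_congr fun ω => ?_
    change ENNReal.ofReal (Φ 0 * jointVersion X (t.toNNReal, ω) / t) *
      u ((t.toNNReal : ℝ), ((jointVersion X (t.toNNReal, ω)).toNNReal : ℝ)) = _
    rcases le_total (jointVersion X (t.toNNReal, ω)) 0 with hneg | hpos
    · rw [ENNReal.ofReal_of_nonpos, zero_mul, mul_zero]
      exact div_nonpos_of_nonpos_of_nonneg (mul_nonpos_of_nonneg_of_nonpos hq.le hneg) ht0.le
    · rw [Real.coe_toNNReal _ ht0.le, Real.coe_toNNReal _ hpos, mul_comm]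
  rw [h.lintegral_max_eq hX hρm hρ he hψ (fun a b ha hb => ?_) hg, hprod hg]
  rw [hprod (u := fun p => ENNReal.ofReal (Real.exp (-a * p.1 - b * p.2))) (by fun_prop),
    div_eq_mul_one_div, ENNReal.ofReal_mul hq.le, ← h.lintegral_marginal_exp hX ha hb,
    ← lintegral_const_mul' _ _ ENNReal.ofReal_ne_top]
  refine setLIntegral_congr_fun measurableSet_Ioi fun t ht => ?_
  have ht0 : 0 < t := ht
  have hpos : 0 ≤ Real.exp (-a * t) / t := by positivity
  rw [← lintegral_const_mul' _ _ ENNReal.ofReal_ne_top,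
    ← lintegral_const_mul' _ _ ENNReal.ofReal_ne_top]
  refine lintegral_congr fun ω => ?_
  rw [← ENNReal.ofReal_mul (Real.exp_nonneg _), ← ENNReal.ofReal_mul hpos,
    ← ENNReal.ofReal_mul hq.le]
  congr 1
  rw [sub_eq_add_neg, Real.exp_add, neg_mul b]
  ring

end Kendall

/-- Proposition: joint law of the time and level of the overall maximum
of a spectrally negative Lévy process drifting to `-∞`.
(i) `E_P[exp(-aρ - bX_ρ)] = q/(q + θ_q⁻¹(a) + b)`;
(ii) `P[ρ ∈ dt, X_ρ ∈ dx] = q P[τ_x ∈ dt] dx = (qx/t) P[X_t ∈ dx] dt` on `(0,∞)²`;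
(iii) `P[ρ ∈ dt] = (q/t) E_P[X_t 1_{X_t > 0}] dt` on `(0,∞)`,
where the density identities are expressed against arbitrary nonnegative measurable
test functions. -/
theorem levy_joint_law_of_maximum
    {Ω : Type*} {m : MeasurableSpace Ω}
    (ℱ : Filtration ℝ≥0 m) (P : Measure Ω) [IsProbabilityMeasure P]
    (X : ℝ≥0 → Ω → ℝ)
    (hadapted : Adapted ℱ X)
    (hmeas : ∀ t, Measurable (X t))
    (h0 : ∀ ω, X 0 ω = 0)
    (hcadlag : ∀ᵐ ω ∂P,
      (∀ t : ℝ≥0, ContinuousWithinAt (fun s => X s ω) (Set.Ici t) t) ∧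
      (∀ t : ℝ≥0, t ≠ 0 → ∃ c : ℝ, Tendsto (fun s => X s ω) (𝓝[<] t) (𝓝 c)))
    (hnoposjump : ∀ᵐ ω ∂P, ∀ t : ℝ≥0, t ≠ 0 →
      X t ω ≤ Function.leftLim (fun s => X s ω) t)
    (hstationary : ∀ s t : ℝ≥0,
      Measure.map (fun ω => X (s + t) ω - X s ω) P = Measure.map (X t) P)
    (hindep : ∀ s t : ℝ≥0, s ≤ t →
      Indep (MeasurableSpace.comap (fun ω => X t ω - X s ω)
        (inferInstance : MeasurableSpace ℝ)) (ℱ s) P)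
    -- non-deterministic
    (hnondet : ¬ ∀ t : ℝ≥0, ∃ c : ℝ, ∀ᵐ ω ∂P, X t ω = c)
    -- not the negative of a subordinator
    (hnotsub : ¬ ∀ᵐ ω ∂P, Antitone fun t => X t ω)
    -- drifts to -∞
    (hdrift : ∀ᵐ ω ∂P, Tendsto (fun t => X t ω) atTop atBot)
    -- the Laplace exponent and the unique positive root q of θ
    (θ : ℝ → ℝ)
    (hLaplace : ∀ z : ℝ, 0 ≤ z → ∀ t : ℝ≥0,
      ∫ ω, Real.exp (z * X t ω) ∂P = Real.exp ((t : ℝ) * θ z))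
    (q : ℝ) (hq : 0 < q) (hθq : θ q = 0)
    (hquniq : ∀ q' : ℝ, 0 < q' → θ q' = 0 → q' = q)
    -- the inverse of θ_q = θ(· + q) on ℝ₊
    (θqinv : ℝ → ℝ)
    (hθqinv : ∀ a : ℝ, 0 ≤ a → 0 ≤ θqinv a ∧ θ (θqinv a + q) = a)
    (hθqinv_mono : StrictMonoOn θqinv (Set.Ici (0:ℝ)))
    -- ρ : the (a.s. unique) time of the overall maximum
    (ρ : Ω → ℝ≥0∞) (hρmeas : Measurable ρ) (hρfin : ∀ᵐ ω ∂P, ρ ω < ⊤)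
    (hρmax : ∀ᵐ ω ∂P, X (ρ ω).toNNReal ω = ⨆ t : ℝ≥0, X t ω) :
    -- (i) joint Laplace transform
    (∀ a b : ℝ, 0 ≤ a → 0 ≤ b →
      ∫ ω, Real.exp (-a * ((ρ ω).toNNReal : ℝ) - b * X (ρ ω).toNNReal ω) ∂P
        = q / (q + θqinv a + b)) ∧
    -- (ii) joint density: against P[τ_x ∈ dt] dx, and against (qx/t) P[X_t ∈ dx] dt
    (∀ g : ℝ × ℝ → ℝ≥0∞, Measurable g →
      (∫⁻ ω, g (((ρ ω).toNNReal : ℝ), X (ρ ω).toNNReal ω) ∂P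
          = ∫⁻ x in Set.Ioi (0:ℝ), ENNReal.ofReal q *
              ∫⁻ ω, (if hitLevel X x ω < ⊤ then
                g (((hitLevel X x ω).toNNReal : ℝ), x) else 0) ∂P) ∧
      (∫⁻ ω, g (((ρ ω).toNNReal : ℝ), X (ρ ω).toNNReal ω) ∂P
          = ∫⁻ t in Set.Ioi (0:ℝ),
              ∫⁻ ω, g (t, X (Real.toNNReal t) ω)
                * ENNReal.ofReal (q * X (Real.toNNReal t) ω / t) ∂P)) ∧
    -- (iii) density of ρ
    (∀ g : ℝ → ℝ≥0∞, Measurable g →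
      ∫⁻ ω, g ((ρ ω).toNNReal : ℝ) ∂P
        = ∫⁻ t in Set.Ioi (0:ℝ), g t * (ENNReal.ofReal (q / t) *
            ∫⁻ ω, ENNReal.ofReal (X (Real.toNNReal t) ω) ∂P)) := by
  have hX : IsSpectrallyNegative ℱ P X := by
    refine ⟨hadapted, ?_, hstationary, hindep⟩
    filter_upwards [hcadlag, hnoposjump] with ω hω hjump
    refine ⟨h0 ω, hω.1, fun t ht => ?_⟩
    obtain ⟨c, hc⟩ := hω.2 t ht
    have : (𝓝[<] t).NeBot := nhdsLT_neBot_of_exists_lt ⟨0, pos_iff_ne_zero.2 ht⟩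
    exact ⟨c, hc, (hjump t ht).trans_eq (leftLim_eq_of_tendsto hc)⟩
  have hroot : θqinv 0 + q = q :=
    hquniq _ (add_pos_of_nonneg_of_pos (hθqinv 0 le_rfl).1 hq) (hθqinv 0 le_rfl).2
  have h : IsLaplaceExponent P X θ fun a => θqinv a + q :=
    { laplace := hLaplace
      inverse_pos := fun a ha => add_pos_of_nonneg_of_pos (hθqinv a ha).1 hq
      apply_inverse := fun a ha => (hθqinv a ha).2
      inverse_mono := hθqinv_mono.add_const q
      root_unique := fun z hz hz0 => by rw [hroot]; exact hquniq z hz hz0 }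
  have hρm : Measurable fun ω => (ρ ω).toNNReal := hρmeas.ennreal_toNNReal
  have hmarginal : ∀ g : ℝ × ℝ → ℝ≥0∞, Measurable g →
      ∫⁻ ω, g (((ρ ω).toNNReal : ℝ), X (ρ ω).toNNReal ω) ∂P = ∫⁻ t in Ioi (0 : ℝ),
        ∫⁻ ω, g (t, X t.toNNReal ω) * ENNReal.ofReal (q * X t.toNNReal ω / t) ∂P :=
    fun g hg => by
      have := h.lintegral_max_eq_marginal hX hρm hρmax hg
      rwa [hroot] at this
  refine ⟨fun a b ha hb => ?_, fun g hg => ⟨?_, hmarginal g hg⟩, fun g hg => ?_⟩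
  · have hJ : Measurable fun ω => jointVersion X ((ρ ω).toNNReal, ω) :=
      (measurable_jointVersion hmeas).comp (hρm.prodMk measurable_id)
    have hXρ : AEMeasurable (fun ω => X (ρ ω).toNNReal ω) P := by
      refine hJ.aemeasurable.congr ?_
      filter_upwards [hX.path] with ω hω using hω.jointVersion_eq _
    have hexp : AEMeasurable (fun ω =>
        Real.exp (-a * ((ρ ω).toNNReal : ℝ) - b * X (ρ ω).toNNReal ω)) P :=
      Real.measurable_exp.comp_aemeasurable
        ((hρm.coe_nnreal_real.aemeasurable.const_mul _).sub (hXρ.const_mul _))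
    have hL := h.lintegral_exp_max hX ha hb hρmax
    have hpos : 0 ≤ θqinv a := (hθqinv a ha).1
    rw [integral_eq_lintegral_of_nonneg_ae (Eventually.of_forall fun ω => Real.exp_nonneg _)
      hexp.aestronglyMeasurable, hL, hroot,
      ENNReal.toReal_ofReal (by positivity), add_comm (θqinv a) q]
  · rw [h.lintegral_max_eq_firstPassage hX hρm hρmax hg, hroot]
    refine setLIntegral_congr_fun measurableSet_Ioi fun x hx => ?_
    congr 1
    refine lintegral_congr_ae ?_
    filter_upwards [h.ae_hitLevel_eq hX hx] with ω hω
    rw [hω]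
  · rw [hmarginal (fun p => g p.1) (hg.comp measurable_fst)]
    refine setLIntegral_congr_fun measurableSet_Ioi fun t ht => ?_
    have ht0 : 0 < t := ht
    dsimp only
    rw [lintegral_const_mul _ (by have := hmeas t.toNNReal; fun_prop),
      ← lintegral_const_mul' _ _ ENNReal.ofReal_ne_top]
    congr 1
    refine lintegral_congr fun ω => ?_
    rw [← ENNReal.ofReal_mul (by positivity)]
    congr 1
    ring

end LevyMax
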